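/- arXiv:2205.05547 — 3 statements merged into one kernel-verified Lean document; each statement's English description precedes it below -/
import Mathlib

section
/- Let γ ≥ 0. Then there exists a constant C > 0 such that for all k ∈ ℤ with k ≥ 1 and all (x,t) ∈ ℝ³ × ℝ: |K_γ^k(x,t)| ≤ C 2^{k(3−γ)} (1 + 2^{k}|(x,t)|)^{−1} · min{1, 2^{k}(1 + 2^{k}|(x,t)|)^{−1/2}}, where |(x,t)| denotes the Euclidean norm of (x,t) ∈ ℝ⁴. -/
open MeasureTheory Real Complex

noncomputable section

/-- `⟨ξ⟩ = √(1+|ξ|²)`. -/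
def jap (ξ : EuclideanSpace ℝ (Fin 3)) : ℝ := Real.sqrt (1 + ‖ξ‖ ^ 2)

/-- The dot product `x·ξ` on `ℝ³`. -/
def dotE (x ξ : EuclideanSpace ℝ (Fin 3)) : ℝ := ∑ i, x i * ξ i

/-- The Littlewood–Paley cutoff `χ_k(ξ) = ρ(2^{-(k+1)}|ξ|) - ρ(2^{-(k-2)}|ξ|)`. -/
def chiLP (ρ : ℝ → ℝ) (k : ℤ) (ξ : EuclideanSpace ℝ (Fin 3)) : ℝ :=
  ρ ((2 : ℝ) ^ (-(k + 1)) * ‖ξ‖) - ρ ((2 : ℝ) ^ (-(k - 2)) * ‖ξ‖)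

/-- The localized kernel `K_γ^k(x,t) = ∫ e^{ix·ξ} e^{it⟨ξ⟩} ⟨ξ⟩^{-γ} χ_k(ξ) dξ`. -/
def Kloc (ρ : ℝ → ℝ) (γ : ℝ) (k : ℤ) (x : EuclideanSpace ℝ (Fin 3)) (t : ℝ) : ℂ :=
  ∫ ξ : EuclideanSpace ℝ (Fin 3),
    Complex.exp (I * ((dotE x ξ : ℝ) + (t : ℝ) * jap ξ)) * ((jap ξ ^ (-γ) * chiLP ρ k ξ : ℝ) : ℂ)

/-- The kernel `K_γ(x,t) = Σ_{k ∈ ℤ} K_γ^k(x,t)`. -/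
def Kker (ρ : ℝ → ℝ) (γ : ℝ) (x : EuclideanSpace ℝ (Fin 3)) (t : ℝ) : ℂ :=
  ∑' k : ℤ, Kloc ρ γ k x t

/-- The Euclidean norm `|(x,t)|` of `(x,t) ∈ ℝ³ × ℝ = ℝ⁴`. -/
def xtNorm (x : EuclideanSpace ℝ (Fin 3)) (t : ℝ) : ℝ := Real.sqrt (‖x‖ ^ 2 + t ^ 2)


open scoped ContDiff Topology

lemma hp_vdc2 {α β : ℝ} (hαβ : α ≤ β) (Ψ Ψ1 Ψ2 g g1 : ℝ → ℝ) {μ G : ℝ} (hμ : 0 < μ)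
    (hΨ : ∀ u ∈ Set.Icc α β, HasDerivAt Ψ (Ψ1 u) u)
    (hΨ1 : ∀ u ∈ Set.Icc α β, HasDerivAt Ψ1 (Ψ2 u) u)
    (hΨ2 : ContinuousOn Ψ2 (Set.Icc α β))
    (hg : ∀ u ∈ Set.Icc α β, HasDerivAt g (g1 u) u)
    (hg1 : ContinuousOn g1 (Set.Icc α β))
    (hlow : ∀ u ∈ Set.Icc α β, μ ≤ Ψ2 u)
    (hG : ∀ u ∈ Set.Icc α β, |g u| ≤ G) (hG1 : ∀ u ∈ Set.Icc α β, |g1 u| ≤ G)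
    (hgα : g α = 0) (hgβ : g β = 0) :
    ‖∫ u in α..β, Complex.exp (I * (Ψ u : ℝ)) * ((g u : ℝ) : ℂ)‖
      ≤ (2 * Real.pi + (β - α)) * G / Real.sqrt μ := by
  have hG0 : 0 ≤ G := (abs_nonneg _).trans (hG α ⟨le_rfl, hαβ⟩)
  set δ := Real.sqrt μ with hδ
  have hδ0 : 0 < δ := Real.sqrt_pos.2 hμ
  have hδ2 : δ ^ 2 = μ := Real.sq_sqrt hμ.le
  have hcΨ : ContinuousOn Ψ (Set.Icc α β) := fun u hu => (hΨ u hu).continuousAt.continuousWithinAt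
  have hcΨ1 : ContinuousOn Ψ1 (Set.Icc α β) :=
    fun u hu => (hΨ1 u hu).continuousAt.continuousWithinAt
  have hcg : ContinuousOn g (Set.Icc α β) := fun u hu => (hg u hu).continuousAt.continuousWithinAt
  have hden : ∀ u, 0 < δ ^ 2 + Ψ1 u ^ 2 := fun u => by positivity
  -- w and its derivative
  let w : ℝ → ℝ := fun u => Ψ1 u / (δ ^ 2 + Ψ1 u ^ 2)
  let w1 : ℝ → ℝ := fun u => (Ψ2 u * (δ ^ 2 + Ψ1 u ^ 2) - Ψ1 u * (2 * Ψ1 u * Ψ2 u)) /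
    (δ ^ 2 + Ψ1 u ^ 2) ^ 2
  have hw : ∀ u ∈ Set.Icc α β, HasDerivAt w (w1 u) u := by
    intro u hu
    have h1 := hΨ1 u hu
    have h2 : HasDerivAt (fun u => δ ^ 2 + Ψ1 u ^ 2) (2 * Ψ1 u * Ψ2 u) u := by
      refine ((h1.fun_pow 2).const_add (δ ^ 2)).congr_deriv ?_
      simp
    exact h1.div h2 (hden u).ne'
  let E : ℝ → ℂ := fun u => Complex.exp (I * (Ψ u : ℝ))
  have hE : ∀ u ∈ Set.Icc α β, HasDerivAt E (E u * (I * (Ψ1 u : ℝ))) u := by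
    intro u hu
    exact (((hΨ u hu).ofReal_comp).const_mul I).cexp
  have hEn : ∀ u, ‖E u‖ = 1 := by
    intro u
    simp only [E]
    rw [mul_comm, Complex.norm_exp_ofReal_mul_I]
  let V : ℝ → ℂ := fun u => E u * ((g u * w u : ℝ) : ℂ)
  let V1 : ℝ → ℂ := fun u => E u * (I * (Ψ1 u : ℝ)) * ((g u * w u : ℝ) : ℂ) +
    E u * ((g1 u * w u + g u * w1 u : ℝ) : ℂ)
  have hV : ∀ u ∈ Set.Icc α β, HasDerivAt V (V1 u) u := by
    intro u hu
    exact (hE u hu).mul (((hg u hu).mul (hw u hu)).ofReal_comp)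
  have hcE : ContinuousOn E (Set.Icc α β) := fun u hu => (hE u hu).continuousAt.continuousWithinAt
  have hcw : ContinuousOn w (Set.Icc α β) := fun u hu => (hw u hu).continuousAt.continuousWithinAt
  have hcw1 : ContinuousOn w1 (Set.Icc α β) := by
    refine ContinuousOn.div (by fun_prop) (by fun_prop) (fun u _ => ?_)
    exact (pow_pos (hden u) 2).ne'
  have hcV1 : ContinuousOn V1 (Set.Icc α β) := by
    have i1 : ContinuousOn (fun u => ((Ψ1 u : ℝ) : ℂ)) (Set.Icc α β) :=
      Complex.continuous_ofReal.comp_continuousOn hcΨ1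
    have i2 : ContinuousOn (fun u => ((g u * w u : ℝ) : ℂ)) (Set.Icc α β) :=
      Complex.continuous_ofReal.comp_continuousOn (hcg.mul hcw)
    have i3 : ContinuousOn (fun u => ((g1 u * w u + g u * w1 u : ℝ) : ℂ)) (Set.Icc α β) :=
      Complex.continuous_ofReal.comp_continuousOn ((hg1.mul hcw).add (hcg.mul hcw1))
    exact ((hcE.mul (continuousOn_const.mul i1)).mul i2).add (hcE.mul i3)
  have huI : Set.uIcc α β = Set.Icc α β := Set.uIcc_of_le hαβ
  have hV1int : IntervalIntegrable V1 volume α β := by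
    apply ContinuousOn.intervalIntegrable; rwa [huI]
  have hV0 : ∫ u in α..β, V1 u = 0 := by
    rw [intervalIntegral.integral_eq_sub_of_hasDerivAt (f := V) (by rw [huI]; exact hV) hV1int]
    simp [V, hgα, hgβ]
  have hEgint : IntervalIntegrable (fun u => E u * ((g u : ℝ) : ℂ)) volume α β := by
    apply ContinuousOn.intervalIntegrable; rw [huI]
    exact hcE.mul (Complex.continuous_ofReal.comp_continuousOn hcg)
  have key : ∫ u in α..β, E u * ((g u : ℝ) : ℂ) =
      ∫ u in α..β, (E u * ((g u : ℝ) : ℂ) + I * V1 u) := by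
    rw [intervalIntegral.integral_add hEgint (hV1int.const_mul I),
      intervalIntegral.integral_const_mul, hV0]
    simp
  change ‖∫ u in α..β, E u * ((g u : ℝ) : ℂ)‖ ≤ _
  rw [key]
  -- primitive of the bound
  let B : ℝ → ℝ := fun u => 2 * G / δ * Real.arctan (Ψ1 u / δ) + G / δ * u
  let B1 : ℝ → ℝ := fun u => 2 * G * (Ψ2 u / (δ ^ 2 + Ψ1 u ^ 2)) + G / δ
  have hB : ∀ u ∈ Set.Icc α β, HasDerivAt B (B1 u) u := by
    intro u hu
    have h1 := (((hΨ1 u hu).div_const δ).arctan).const_mul (2 * G / δ)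
    have h2 := (hasDerivAt_id' u).const_mul (G / δ)
    refine (h1.fun_add h2).congr_deriv ?_
    simp only [B1]
    have := (hden u).ne'
    have h3 : 1 + (Ψ1 u / δ) ^ 2 = (δ ^ 2 + Ψ1 u ^ 2) / δ ^ 2 := by field_simp
    rw [h3]
    field_simp
  have hcB1 : ContinuousOn B1 (Set.Icc α β) := by
    have : ContinuousOn (fun u => Ψ2 u / (δ ^ 2 + Ψ1 u ^ 2)) (Set.Icc α β) :=
      ContinuousOn.div hΨ2 (by fun_prop) (fun u _ => (hden u).ne')
    exact (continuousOn_const.mul this).add continuousOn_const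
  have hB1int : IntervalIntegrable B1 volume α β := by
    apply ContinuousOn.intervalIntegrable; rwa [huI]
  have hpt : ∀ u ∈ Set.Icc α β, ‖E u * ((g u : ℝ) : ℂ) + I * V1 u‖ ≤ B1 u := by
    intro u hu
    have hd := hden u
    have e1 : E u * ((g u : ℝ) : ℂ) + I * V1 u =
        E u * (((g u * (δ ^ 2 / (δ ^ 2 + Ψ1 u ^ 2)) : ℝ) : ℂ) +
          I * ((g1 u * w u + g u * w1 u : ℝ) : ℂ)) := by
      have e2 : δ ^ 2 / (δ ^ 2 + Ψ1 u ^ 2) = 1 - Ψ1 u * w u := by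
        simp only [w]; field_simp; ring
      rw [e2]
      simp only [V1]
      push_cast
      linear_combination (E u * (Ψ1 u) * (g u) * (w u)) * Complex.I_mul_I
    rw [e1, norm_mul, hEn, one_mul]
    have hwb : |w u| ≤ 1 / δ := by
      simp only [w]
      rw [abs_div, abs_of_pos hd, div_le_div_iff₀ hd hδ0]
      have := sq_abs (Ψ1 u)
      nlinarith [sq_nonneg (|Ψ1 u| - δ), abs_nonneg (Ψ1 u)]
    have hΨ2p : 0 < Ψ2 u := hμ.trans_le (hlow u hu)
    have hw1b : |w1 u| ≤ Ψ2 u / (δ ^ 2 + Ψ1 u ^ 2) := by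
      simp only [w1]
      rw [abs_div, abs_of_pos (pow_pos hd 2), div_le_div_iff₀ (pow_pos hd 2) hd]
      have : |Ψ2 u * (δ ^ 2 + Ψ1 u ^ 2) - Ψ1 u * (2 * Ψ1 u * Ψ2 u)| ≤
          Ψ2 u * (δ ^ 2 + Ψ1 u ^ 2) := by
        rw [abs_le]
        have a1 : 0 ≤ Ψ2 u * δ ^ 2 := by positivity
        have a2 : 0 ≤ Ψ2 u * Ψ1 u ^ 2 := by positivity
        constructor <;> nlinarith
      nlinarith
    calc ‖((g u * (δ ^ 2 / (δ ^ 2 + Ψ1 u ^ 2)) : ℝ) : ℂ) +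
          I * ((g1 u * w u + g u * w1 u : ℝ) : ℂ)‖
        ≤ |g u * (δ ^ 2 / (δ ^ 2 + Ψ1 u ^ 2))| + |g1 u * w u + g u * w1 u| := by
          refine (norm_add_le _ _).trans ?_
          rw [norm_mul, Complex.norm_I, one_mul, Complex.norm_real, Complex.norm_real,
            Real.norm_eq_abs, Real.norm_eq_abs]
      _ ≤ G * (Ψ2 u / (δ ^ 2 + Ψ1 u ^ 2)) + (G * (1 / δ) + G * (Ψ2 u / (δ ^ 2 + Ψ1 u ^ 2))) := by
          refine add_le_add ?_ ((abs_add_le _ _).trans (add_le_add ?_ ?_))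
          · rw [abs_mul]
            refine mul_le_mul (hG u hu) ?_ (abs_nonneg _) hG0
            rw [abs_of_pos (by positivity)]
            gcongr
            rw [hδ2]; exact hlow u hu
          · rw [abs_mul]; exact mul_le_mul (hG1 u hu) hwb (abs_nonneg _) hG0
          · rw [abs_mul]; exact mul_le_mul (hG u hu) hw1b (abs_nonneg _) hG0
      _ = B1 u := by simp only [B1]; ring
  refine (intervalIntegral.norm_integral_le_of_norm_le hαβ (g := B1) ?_ hB1int).trans ?_
  · refine Filter.Eventually.of_forall (fun u hu => hpt u ⟨hu.1.le, hu.2⟩)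
  · rw [intervalIntegral.integral_eq_sub_of_hasDerivAt (f := B) (by rw [huI]; exact hB) hB1int]
    simp only [B]
    have a1 := Real.arctan_lt_pi_div_two (Ψ1 β / δ)
    have a2 := Real.neg_pi_div_two_lt_arctan (Ψ1 α / δ)
    have hc : 0 ≤ 2 * G / δ := by positivity
    have := mul_le_mul_of_nonneg_left (show Real.arctan (Ψ1 β / δ) - Real.arctan (Ψ1 α / δ) ≤ Real.pi
      by linarith) hc
    calc _ = 2 * G / δ * (Real.arctan (Ψ1 β / δ) - Real.arctan (Ψ1 α / δ)) + G / δ * (β - α) := by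
          ring
      _ ≤ 2 * G / δ * Real.pi + G / δ * (β - α) := by gcongr
      _ = _ := by ring

/-- partial derivative in the last variable -/
def hpDu {E : Type*} [NormedAddCommGroup E] [NormedSpace ℝ E] (A : E × ℝ → ℝ) : E × ℝ → ℝ :=
  fun q => fderiv ℝ A q (0, 1)

section
variable {E : Type*} [NormedAddCommGroup E] [NormedSpace ℝ E]

lemma hpDu_smooth {A : E × ℝ → ℝ} {q : E × ℝ} (h : ContDiffAt ℝ ∞ A q) :
    ContDiffAt ℝ ∞ (hpDu A) q := by
  have := h.fderiv_right (m := ∞) (by simp)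
  exact this.clm_apply contDiffAt_const

lemma hpDu_hasDeriv {A : E × ℝ → ℝ} {p : E} {u : ℝ} (h : ContDiffAt ℝ ∞ A (p, u)) :
    HasDerivAt (fun v => A (p, v)) (hpDu A (p, u)) u := by
  have h1 : HasFDerivAt A (fderiv ℝ A (p, u)) (p, u) :=
    (h.differentiableAt (by simp)).hasFDerivAt
  have h2 : HasDerivAt (fun v : ℝ => (p, v)) ((0 : E), (1 : ℝ)) u :=
    (hasDerivAt_const u p).prodMk (hasDerivAt_id u)
  exact h1.comp_hasDerivAt u h2

lemma hpDu_zero {A : E × ℝ → ℝ} {q : E × ℝ} (h : A =ᶠ[𝓝 q] 0) : hpDu A =ᶠ[𝓝 q] 0 := by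
  have := h.fderiv (𝕜 := ℝ)
  filter_upwards [this] with x hx
  simp [hpDu, hx]

/-- the transposed operator used in integration by parts -/
def hpL (Θ A : E × ℝ → ℝ) : E × ℝ → ℝ := hpDu (fun q => A q / hpDu Θ q)

lemma hpL_smooth {Θ A : E × ℝ → ℝ} {q : E × ℝ} (h : ContDiffAt ℝ ∞ A q)
    (hΘ : ContDiffAt ℝ ∞ Θ q) (h0 : hpDu Θ q ≠ 0) : ContDiffAt ℝ ∞ (hpL Θ A) q :=
  hpDu_smooth (h.div (hpDu_smooth hΘ) h0)

lemma hpL_zero {Θ A : E × ℝ → ℝ} {q : E × ℝ} (h : A =ᶠ[𝓝 q] 0) : hpL Θ A =ᶠ[𝓝 q] 0 := by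
  apply hpDu_zero
  filter_upwards [h] with x hx
  simp [hx]

lemma hp_cont {A : E × ℝ → ℝ} {p : E} {s : Set ℝ} (h : ∀ u ∈ s, ContDiffAt ℝ ∞ A (p, u)) :
    ContinuousOn (fun u => A (p, u)) s := fun u hu =>
  (hpDu_hasDeriv (h u hu)).continuousAt.continuousWithinAt

lemma hp_ibp {Θ A : E × ℝ → ℝ} {p : E} {α β T : ℝ} (hαβ : α ≤ β) (hT : T ≠ 0)
    (hA : ∀ u ∈ Set.Icc α β, ContDiffAt ℝ ∞ A (p, u))
    (hΘ : ∀ u ∈ Set.Icc α β, ContDiffAt ℝ ∞ Θ (p, u))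
    (h0 : ∀ u ∈ Set.Icc α β, hpDu Θ (p, u) ≠ 0)
    (hα : A =ᶠ[𝓝 (p, α)] 0) (hβ : A =ᶠ[𝓝 (p, β)] 0) :
    ∫ u in α..β, Complex.exp (I * ((T * Θ (p, u) : ℝ) : ℂ)) * ((A (p, u) : ℝ) : ℂ) =
      (I / T) * ∫ u in α..β, Complex.exp (I * ((T * Θ (p, u) : ℝ) : ℂ)) *
        ((hpL Θ A (p, u) : ℝ) : ℂ) := by
  have huI : Set.uIcc α β = Set.Icc α β := Set.uIcc_of_le hαβ
  let F : E × ℝ → ℝ := fun q => A q / hpDu Θ q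
  have hF : ∀ u ∈ Set.Icc α β, ContDiffAt ℝ ∞ F (p, u) := fun u hu =>
    (hA u hu).div (hpDu_smooth (hΘ u hu)) (h0 u hu)
  let e : ℝ → ℂ := fun u => Complex.exp (I * ((T * Θ (p, u) : ℝ) : ℂ))
  have he : ∀ u ∈ Set.Icc α β, HasDerivAt e (e u * (I * ((T * hpDu Θ (p, u) : ℝ) : ℂ))) u := by
    intro u hu
    exact ((((hpDu_hasDeriv (hΘ u hu)).const_mul T).ofReal_comp).const_mul I).cexp
  have hV : ∀ u ∈ Set.Icc α β, HasDerivAt (fun u => e u * ((F (p, u) : ℝ) : ℂ))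
      (e u * (I * ((T * hpDu Θ (p, u) : ℝ) : ℂ)) * ((F (p, u) : ℝ) : ℂ) +
        e u * ((hpL Θ A (p, u) : ℝ) : ℂ)) u := fun u hu =>
    (he u hu).mul ((hpDu_hasDeriv (hF u hu)).ofReal_comp)
  have hV' : ∀ u ∈ Set.Icc α β, HasDerivAt (fun u => e u * ((F (p, u) : ℝ) : ℂ))
      (I * T * (e u * ((A (p, u) : ℝ) : ℂ)) + e u * ((hpL Θ A (p, u) : ℝ) : ℂ)) u := by
    intro u hu
    convert hV u hu using 2
    have : A (p, u) = hpDu Θ (p, u) * F (p, u) := by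
      simp only [F]; field_simp [h0 u hu]
    rw [this]; push_cast; ring
  have hce : ContinuousOn e (Set.Icc α β) := fun u hu => (he u hu).continuousAt.continuousWithinAt
  have i1 : IntervalIntegrable (fun u => e u * ((A (p, u) : ℝ) : ℂ)) volume α β := by
    apply ContinuousOn.intervalIntegrable; rw [huI]
    exact hce.mul (Complex.continuous_ofReal.comp_continuousOn (hp_cont hA))
  have i2 : IntervalIntegrable (fun u => e u * ((hpL Θ A (p, u) : ℝ) : ℂ)) volume α β := by
    apply ContinuousOn.intervalIntegrable; rw [huI]
    exact hce.mul (Complex.continuous_ofReal.comp_continuousOn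
      (hp_cont (fun u hu => hpL_smooth (hA u hu) (hΘ u hu) (h0 u hu))))
  have key := intervalIntegral.integral_eq_sub_of_hasDerivAt (a := α) (b := β)
    (by rw [huI]; exact hV') ((i1.const_mul (I * T)).add i2)
  rw [intervalIntegral.integral_add (i1.const_mul (I * T)) i2,
    intervalIntegral.integral_const_mul] at key
  have z1 : F (p, α) = 0 := by simp [F, hα.eq_of_nhds]
  have z2 : F (p, β) = 0 := by simp [F, hβ.eq_of_nhds]
  rw [z1, z2] at key
  simp only [Complex.ofReal_zero, mul_zero, sub_self] at key
  change ∫ u in α..β, e u * ((A (p, u) : ℝ) : ℂ) = (I / T) * ∫ u in α..β, e u * ((hpL Θ A (p, u) : ℝ) : ℂ)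
  have hTC : (T : ℂ) ≠ 0 := by exact_mod_cast hT
  have h3 : ∫ u in α..β, e u * ((hpL Θ A (p, u) : ℝ) : ℂ) =
    - (I * T * ∫ u in α..β, e u * ((A (p, u) : ℝ) : ℂ)) := by
    linear_combination key
  rw [h3]
  field_simp
  linear_combination ((∫ u in α..β, e u * ((A (p, u) : ℝ) : ℂ))) * Complex.I_sq

lemma hp_bound {A : E × ℝ → ℝ} {P : Set E} (hP : IsCompact P) {α β : ℝ}
    (hA : ∀ p ∈ P, ∀ u ∈ Set.Icc α β, ContDiffAt ℝ ∞ A (p, u)) :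
    ∃ C : ℝ, 0 ≤ C ∧ ∀ p ∈ P, ∀ u ∈ Set.Icc α β, |A (p, u)| ≤ C := by
  have hK : IsCompact (P ×ˢ Set.Icc α β) := hP.prod isCompact_Icc
  obtain ⟨C, hC⟩ := hK.exists_bound_of_continuousOn (f := A)
    (fun q hq => (hA q.1 hq.1 q.2 hq.2).continuousAt.continuousWithinAt)
  refine ⟨max C 0, le_max_right _ _, fun p hp u hu => ?_⟩
  exact (hC (p, u) ⟨hp, hu⟩).trans (le_max_left _ _)

lemma hp_norm_le {α β C : ℝ} (hαβ : α ≤ β) (Ψ A : ℝ → ℝ) (h : ∀ u ∈ Set.Icc α β, |A u| ≤ C) :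
    ‖∫ u in α..β, Complex.exp (I * (Ψ u : ℝ)) * ((A u : ℝ) : ℂ)‖ ≤ C * (β - α) := by
  have := intervalIntegral.norm_integral_le_of_norm_le_const (a := α) (b := β) (C := C)
    (f := fun u => Complex.exp (I * (Ψ u : ℝ)) * ((A u : ℝ) : ℂ)) (by
      intro u hu
      rw [Set.uIoc_of_le hαβ] at hu
      rw [norm_mul, mul_comm I, Complex.norm_exp_ofReal_mul_I, one_mul, Complex.norm_real]
      exact h u ⟨hu.1.le, hu.2⟩)
  rwa [abs_of_nonneg (by linarith)] at this

lemma hp_nonstat {Θ A : E × ℝ → ℝ} {P : Set E} (hP : IsCompact P) {α β : ℝ} (hαβ : α ≤ β)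
    (hA : ∀ p ∈ P, ∀ u ∈ Set.Icc α β, ContDiffAt ℝ ∞ A (p, u))
    (hΘ : ∀ p ∈ P, ∀ u ∈ Set.Icc α β, ContDiffAt ℝ ∞ Θ (p, u))
    (h0 : ∀ p ∈ P, ∀ u ∈ Set.Icc α β, hpDu Θ (p, u) ≠ 0)
    (hα : ∀ p ∈ P, A =ᶠ[𝓝 (p, α)] 0) (hβ : ∀ p ∈ P, A =ᶠ[𝓝 (p, β)] 0) :
    ∃ C : ℝ, 0 ≤ C ∧ ∀ p ∈ P, ∀ T : ℝ, 0 < T →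
      ‖∫ u in α..β, Complex.exp (I * ((T * Θ (p, u) : ℝ) : ℂ)) * ((A (p, u) : ℝ) : ℂ)‖
        ≤ C / T ^ 2 := by
  have hL1 : ∀ p ∈ P, ∀ u ∈ Set.Icc α β, ContDiffAt ℝ ∞ (hpL Θ A) (p, u) := fun p hp u hu =>
    hpL_smooth (hA p hp u hu) (hΘ p hp u hu) (h0 p hp u hu)
  have hL2 : ∀ p ∈ P, ∀ u ∈ Set.Icc α β, ContDiffAt ℝ ∞ (hpL Θ (hpL Θ A)) (p, u) :=
    fun p hp u hu => hpL_smooth (hL1 p hp u hu) (hΘ p hp u hu) (h0 p hp u hu)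
  obtain ⟨C, hC0, hC⟩ := hp_bound hP hL2
  refine ⟨C * (β - α), mul_nonneg hC0 (by linarith), fun p hp T hT => ?_⟩
  rw [hp_ibp hαβ hT.ne' (hA p hp) (hΘ p hp) (h0 p hp) (hα p hp) (hβ p hp),
    hp_ibp hαβ hT.ne' (hL1 p hp) (hΘ p hp) (h0 p hp) (hpL_zero (hα p hp)) (hpL_zero (hβ p hp))]
  have h1 := hp_norm_le hαβ (fun u => T * Θ (p, u)) (fun u => hpL Θ (hpL Θ A) (p, u)) (hC p hp)
  rw [norm_mul, norm_mul, norm_div, Complex.norm_I, Complex.norm_real, Real.norm_of_nonneg hT.le]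
  calc _ = ‖∫ u in α..β, Complex.exp (I * ((T * Θ (p, u) : ℝ) : ℂ)) *
        ((hpL Θ (hpL Θ A) (p, u) : ℝ) : ℂ)‖ / T ^ 2 := by field_simp
    _ ≤ _ := by gcongr

end


abbrev hpE3 := EuclideanSpace ℝ (Fin 3)

lemma hp_rot (x : hpE3) : ∃ b : OrthonormalBasis (Fin 3) ℝ hpE3,
    ∀ ξ, dotE x ξ = ‖x‖ * (b.repr ξ) 0 := by
  have hdot : ∀ ξ, dotE x ξ = inner ℝ x ξ := by
    intro ξ
    simp only [dotE, PiLp.inner_apply, RCLike.inner_apply, conj_trivial]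
    exact Finset.sum_congr rfl (fun i _ => mul_comm _ _)
  by_cases hx : x = 0
  · refine ⟨EuclideanSpace.basisFun _ _, fun ξ => ?_⟩
    rw [hdot]; simp [hx]
  · have hx' : ‖x‖ ≠ 0 := norm_ne_zero_iff.2 hx
    have hv : Orthonormal ℝ (({0} : Set (Fin 3)).domRestrict
        (fun _ : Fin 3 => (‖x‖⁻¹ • x : hpE3))) := by
      constructor
      · intro i
        simp [Set.domRestrict, norm_smul, hx']
      · intro i j hij
        exact absurd (Subsingleton.elim i j) hij
    obtain ⟨b, hb⟩ := hv.exists_orthonormalBasis_extension_of_card_eq (by simp)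
    refine ⟨b, fun ξ => ?_⟩
    rw [hdot, OrthonormalBasis.repr_apply_apply, hb 0 (by simp), real_inner_smul_left]
    field_simp

lemma hp_cyl (H : ℝ → ℝ → ℂ) (hH : Continuous (Function.uncurry H)) (R : ℝ)
    (hR : ∀ z r, R ≤ r → H z r = 0) :
    ∫ ξ : hpE3, H (ξ 0) ‖ξ‖ = ∫ z : ℝ, ∫ w : ℂ, H z (Real.sqrt (z ^ 2 + ‖w‖ ^ 2)) := by
  have m1 := PiLp.volume_preserving_toLp (Fin 3)
  have m2 := (volume_preserving_piFinSuccAbove (fun _ : Fin 3 => ℝ) 0).symm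
  have m3 : MeasurePreserving (MeasurableEquiv.prodCongr (MeasurableEquiv.refl ℝ)
      Complex.measurableEquivPi) (volume : Measure (ℝ × ℂ)) (volume : Measure (ℝ × (Fin 2 → ℝ))) :=
    (MeasurePreserving.id volume).prod Complex.volume_preserving_equiv_pi
  rw [← m1.integral_comp (MeasurableEquiv.toLp 2 (Fin 3 → ℝ)).measurableEmbedding,
    ← m2.integral_comp (MeasurableEquiv.measurableEmbedding _),
    ← m3.integral_comp (MeasurableEquiv.measurableEmbedding _)]
  have e : ∀ q : ℝ × ℂ, (fun ξ : hpE3 => H (ξ 0) ‖ξ‖) (WithLp.toLp 2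
      ((MeasurableEquiv.piFinSuccAbove (fun _ : Fin 3 => ℝ) 0).symm
        ((MeasurableEquiv.prodCongr (MeasurableEquiv.refl ℝ) Complex.measurableEquivPi) q))) =
      H q.1 (Real.sqrt (q.1 ^ 2 + ‖q.2‖ ^ 2)) := by
    rintro ⟨z, w⟩
    have h0 : ((MeasurableEquiv.piFinSuccAbove (fun _ : Fin 3 => ℝ) 0).symm
        ((MeasurableEquiv.prodCongr (MeasurableEquiv.refl ℝ) Complex.measurableEquivPi) (z, w))) =
        ![z, w.re, w.im] := by
      funext i
      fin_cases i <;> rfl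
    rw [h0]
    simp only [EuclideanSpace.norm_eq]
    have h1 : ‖w‖ ^ 2 = w.re ^ 2 + w.im ^ 2 := by
      rw [← Complex.normSq_eq_norm_sq, Complex.normSq_apply]; ring
    rw [h1]
    simp [Fin.sum_univ_three, add_assoc]
  have e' := funext e
  rw [show (∫ q : ℝ × ℂ, _) = ∫ q : ℝ × ℂ, H q.1 (Real.sqrt (q.1 ^ 2 + ‖q.2‖ ^ 2)) from
    integral_congr_ae (Filter.Eventually.of_forall e)]
  rw [Measure.volume_eq_prod, integral_prod]
  apply Continuous.integrable_of_hasCompactSupport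
  · have : Continuous (fun q : ℝ × ℂ => (q.1, Real.sqrt (q.1 ^ 2 + ‖q.2‖ ^ 2))) := by fun_prop
    exact hH.comp this
  · apply HasCompactSupport.intro (K := Metric.closedBall 0 |R|) (isCompact_closedBall _ _)
    rintro ⟨z, w⟩ hq
    apply hR
    simp only [Metric.mem_closedBall, dist_zero_right, not_le] at hq
    have h1 : ‖((z, w) : ℝ × ℂ)‖ ≤ Real.sqrt (z ^ 2 + ‖w‖ ^ 2) := by
      rw [Prod.norm_def]
      apply max_le
      · apply Real.le_sqrt_of_sq_le
        simp only [Real.norm_eq_abs, sq_abs]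
        nlinarith [sq_nonneg ‖w‖]
      · apply Real.le_sqrt_of_sq_le
        simp only
        nlinarith [sq_nonneg z]
    exact (le_abs_self R).trans (hq.le.trans h1)

lemma hp_disk (G : ℝ → ℂ) : ∫ w : ℂ, G ‖w‖ = (2 * Real.pi : ℝ) * ∫ y in Set.Ioi (0:ℝ), (y : ℂ) * G y := by
  rw [integral_fun_norm_addHaar volume G]
  simp only [Complex.finrank_real_complex, Measure.real, Complex.volume_ball]
  simp
  ring

lemma hp_sub (F : ℝ → ℂ) (hF : Continuous F) (R : ℝ) (hR : ∀ r, R ≤ r → F r = 0) (z : ℝ) :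
    ∫ y in Set.Ioi (0:ℝ), (y : ℂ) * F (Real.sqrt (z ^ 2 + y ^ 2)) =
      ∫ r in Set.Ioi |z|, (r : ℂ) * F r := by
  have h := integral_deriv_smul_comp_Ioi (f := fun y : ℝ => Real.sqrt (z ^ 2 + y ^ 2))
    (f' := fun y => y / Real.sqrt (z ^ 2 + y ^ 2)) (g := fun r : ℝ => (r : ℂ) * F r) (a := 0)
    (by fun_prop) ?_ ?_ ?_ ?_ ?_
  · simp only [ne_eq, OfNat.ofNat_ne_zero, not_false_eq_true, zero_pow, add_zero,
      Real.sqrt_sq_eq_abs] at h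
    rw [← h]
    apply setIntegral_congr_fun measurableSet_Ioi
    intro y hy
    have hs : 0 < Real.sqrt (z ^ 2 + y ^ 2) := Real.sqrt_pos.2 (by have : (0:ℝ) < y := hy; positivity)
    simp only [Function.comp, Complex.real_smul]
    push_cast
    have : ((Real.sqrt (z ^ 2 + y ^ 2) : ℝ) : ℂ) ≠ 0 := by exact_mod_cast hs.ne'
    field_simp
  · apply Filter.tendsto_atTop_mono (f := fun y : ℝ => y) _ Filter.tendsto_id
    intro y
    apply Real.le_sqrt_of_sq_le
    nlinarith [sq_nonneg z]
  · intro y hy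
    have hy : (0:ℝ) < y := hy
    have h1 : HasDerivAt (fun y : ℝ => z ^ 2 + y ^ 2) (2 * y) y := by
      refine ((hasDerivAt_id' y).fun_pow 2).const_add (z ^ 2) |>.congr_deriv ?_
      simp
    have := (h1.sqrt (by positivity)).hasDerivWithinAt (s := Set.Ioi y)
    refine this.congr_deriv ?_
    have hs : Real.sqrt (z ^ 2 + y ^ 2) ≠ 0 := (Real.sqrt_pos.2 (by positivity)).ne'
    field_simp
  · fun_prop
  · have h0 : IntegrableOn (fun r : ℝ => (r : ℂ) * F r) (Set.Icc 0 |R|) volume :=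
      (by fun_prop : Continuous (fun r : ℝ => (r : ℂ) * F r)).continuousOn.integrableOn_Icc
    refine (h0.of_forall_sdiff_eq_zero (t := Set.Ici 0) measurableSet_Ici ?_).mono_set ?_
    · rintro r ⟨hr, hr2⟩
      have : R ≤ r := by
        by_contra hc
        exact hr2 ⟨hr, (not_le.1 hc).le.trans (le_abs_self R)⟩
      simp [hR r this]
    · rintro _ ⟨y, _, rfl⟩
      exact Real.sqrt_nonneg _
  · have h0 : IntegrableOn (fun y : ℝ => (y : ℂ) * F (Real.sqrt (z ^ 2 + y ^ 2)))
        (Set.Icc 0 |R|) volume :=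
      (by fun_prop : Continuous
        (fun y : ℝ => (y : ℂ) * F (Real.sqrt (z ^ 2 + y ^ 2)))).continuousOn.integrableOn_Icc
    have h1 : IntegrableOn (fun y : ℝ => (y : ℂ) * F (Real.sqrt (z ^ 2 + y ^ 2)))
        (Set.Ici 0) volume := by
      refine h0.of_forall_sdiff_eq_zero measurableSet_Ici ?_
      rintro r ⟨hr, hr2⟩
      have : R ≤ r := by
        by_contra hc
        exact hr2 ⟨hr, (not_le.1 hc).le.trans (le_abs_self R)⟩
      rw [hR _ (this.trans ?_), mul_zero]
      apply Real.le_sqrt_of_sq_le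
      nlinarith [sq_nonneg z]
    refine h1.congr_fun (fun y hy => ?_) measurableSet_Ici
    simp only [Function.comp, Complex.real_smul]
    rcases eq_or_lt_of_le (show (0:ℝ) ≤ y from hy) with h | h
    · simp [← h]
    · have hs : 0 < Real.sqrt (z ^ 2 + y ^ 2) := Real.sqrt_pos.2 (by positivity)
      push_cast
      have : ((Real.sqrt (z ^ 2 + y ^ 2) : ℝ) : ℂ) ≠ 0 := by exact_mod_cast hs.ne'
      field_simp

lemma hp_swap (e F : ℝ → ℂ) (he : Continuous e) (hF : Continuous F) (R : ℝ)
    (hR : ∀ r, R ≤ r → F r = 0) (h0 : ∀ r ≤ 0, F r = 0) :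
    ∫ z : ℝ, e z * ∫ r in Set.Ioi |z|, (r : ℂ) * F r =
      ∫ r : ℝ, (r : ℂ) * F r * ∫ z in (-r)..r, e z := by
  let S : Set (ℝ × ℝ) := {q | |q.1| < q.2}
  have hS : MeasurableSet S := measurableSet_lt (by fun_prop) (by fun_prop)
  let f : ℝ → ℝ → ℂ := fun z r => S.indicator (fun q => e q.1 * ((q.2 : ℂ) * F q.2)) (z, r)
  have hf : Integrable (Function.uncurry f) (volume.prod volume) := by
    change Integrable (S.indicator (fun q => e q.1 * ((q.2 : ℂ) * F q.2))) (volume.prod volume)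
    rw [integrable_indicator_iff hS]
    have hc : Continuous (fun q : ℝ × ℝ => e q.1 * ((q.2 : ℂ) * F q.2)) := by fun_prop
    have hK : IsCompact (Set.Icc (-R) R ×ˢ Set.Icc 0 R) := isCompact_Icc.prod isCompact_Icc
    have := hc.continuousOn.integrableOn_compact (μ := (volume : Measure ℝ).prod volume) hK
    refine this.of_forall_sdiff_eq_zero hS ?_
    rintro ⟨z, r⟩ ⟨h1, h2⟩
    have h1 : |z| < r := h1
    have : R ≤ r := by
      by_contra hc
      apply h2
      have := abs_lt.1 h1
      have := abs_nonneg z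
      refine ⟨⟨?_, ?_⟩, ⟨?_, ?_⟩⟩ <;> simp only <;> linarith
    simp [hR r this]
  have hsw := integral_integral_swap hf
  have l : ∀ z, ∫ r, f z r = e z * ∫ r in Set.Ioi |z|, (r : ℂ) * F r := by
    intro z
    rw [← integral_const_mul, ← integral_indicator measurableSet_Ioi]
    congr 1
  have r : ∀ r, ∫ z, f z r = (r : ℂ) * F r * ∫ z in (-r)..r, e z := by
    intro r
    rcases le_or_gt r 0 with hr | hr
    · simp only [f, Set.indicator]
      simp [h0 r hr]
    · rw [intervalIntegral.integral_of_le (by linarith), integral_Ioc_eq_integral_Ioo, ← integral_const_mul, ← integral_indicator measurableSet_Ioo]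
      congr 1
      funext z
      simp only [f, Set.indicator, S, Set.mem_Ioo]
      have : (z, r) ∈ {q : ℝ × ℝ | |q.1| < q.2} ↔ (-r < z ∧ z < r) := by
        rw [← abs_lt]; rfl
      simp only [this]
      split_ifs <;> ring
  simp only [l, r] at hsw
  exact hsw

lemma hp_polar (F : ℝ → ℂ) (hF : Continuous F) (R : ℝ)
    (hR : ∀ r, R ≤ r → F r = 0) (h0 : ∀ r ≤ 0, F r = 0) (x : hpE3) :
    ∫ ξ : hpE3, Complex.exp (I * (dotE x ξ : ℝ)) * F ‖ξ‖ =
      (2 * Real.pi : ℝ) * ∫ r : ℝ, (r : ℂ) * F r * ∫ z in (-r)..r,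
        Complex.exp (I * ((‖x‖ * z : ℝ) : ℂ)) := by
  obtain ⟨b, hb⟩ := hp_rot x
  have e1 : ∫ ξ : hpE3, Complex.exp (I * (dotE x ξ : ℝ)) * F ‖ξ‖ =
      ∫ ξ : hpE3, Complex.exp (I * ((‖x‖ * ξ 0 : ℝ) : ℂ)) * F ‖ξ‖ := by
    rw [← b.measurePreserving_repr.integral_comp b.repr.toHomeomorph.measurableEmbedding
      (fun ξ : hpE3 => Complex.exp (I * ((‖x‖ * ξ 0 : ℝ) : ℂ)) * F ‖ξ‖)]
    simp only [hb, LinearIsometryEquiv.norm_map]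
  rw [e1, hp_cyl (fun z r => Complex.exp (I * ((‖x‖ * z : ℝ) : ℂ)) * F r) (by
    simp only [Function.uncurry_def]; fun_prop) R (fun z r hr => by simp [hR r hr])]
  have e2 : ∀ z : ℝ, ∫ w : ℂ, Complex.exp (I * ((‖x‖ * z : ℝ) : ℂ)) *
      F (Real.sqrt (z ^ 2 + ‖w‖ ^ 2)) = (2 * Real.pi : ℝ) *
        (Complex.exp (I * ((‖x‖ * z : ℝ) : ℂ)) * ∫ r in Set.Ioi |z|, (r : ℂ) * F r) := by
    intro z
    rw [integral_const_mul, hp_disk (fun y => F (Real.sqrt (z ^ 2 + y ^ 2))), hp_sub F hF R hR]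
    ring
  simp only [e2]
  rw [integral_const_mul, hp_swap _ F (by fun_prop) hF R hR h0]


/-- parameter space `(ε, b, c)` together with the variable `u` -/
abbrev hpQ := (ℝ × ℝ × ℝ) × ℝ

def hpφ (q : hpQ) : ℝ := Real.sqrt (q.1.1 ^ 2 + q.2 ^ 2)

def hpΘ (q : hpQ) : ℝ := q.1.2.1 * q.2 + q.1.2.2 * hpφ q

def hpA (γ : ℝ) (ρ : ℝ → ℝ) (j : ℕ) (q : hpQ) : ℝ :=
  q.2 ^ j * hpφ q ^ (-γ) * (ρ (q.2 / 2) - ρ (4 * q.2))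

lemma hpφ_pos {q : hpQ} (h : 0 < q.2) : 0 < hpφ q := Real.sqrt_pos.2 (by positivity)

lemma hpφ_smooth {q : hpQ} (h : 0 < q.2) : ContDiffAt ℝ ∞ hpφ q := by
  have : q.1.1 ^ 2 + q.2 ^ 2 ≠ 0 := by positivity
  have h1 : ContDiffAt ℝ ∞ (fun q : hpQ => q.1.1 ^ 2 + q.2 ^ 2) q := by fun_prop
  exact h1.sqrt this

lemma hpΘ_smooth {q : hpQ} (h : 0 < q.2) : ContDiffAt ℝ ∞ hpΘ q := by
  have := hpφ_smooth h
  unfold hpΘ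
  fun_prop

lemma hpA_smooth {γ : ℝ} {ρ : ℝ → ℝ} (hρ : ContDiff ℝ (⊤ : ℕ∞) ρ) (j : ℕ) {q : hpQ}
    (h : 0 < q.2) : ContDiffAt ℝ ∞ (hpA γ ρ j) q := by
  have h1 := (hpφ_smooth h).rpow_const_of_ne (p := -γ) (hpφ_pos h).ne'
  have h2 : ContDiffAt ℝ ∞ (fun q : hpQ => ρ (q.2 / 2)) q :=
    hρ.contDiffAt.comp q (by fun_prop)
  have h3 : ContDiffAt ℝ ∞ (fun q : hpQ => ρ (4 * q.2)) q :=
    hρ.contDiffAt.comp q (by fun_prop)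
  have h4 : ContDiffAt ℝ ∞ (fun q : hpQ => q.2 ^ j) q := by fun_prop
  exact (h4.mul h1).mul (h2.sub h3)

lemma hp_chi_zero {ρ : ℝ → ℝ} (hρsupp : Function.support ρ ⊆ Set.Ioo (-2) 2)
    (hρ1 : ∀ s : ℝ, |s| ≤ 1 → ρ s = 1) {u : ℝ} (h : |u| ≤ 1 / 4 ∨ 4 ≤ |u|) :
    ρ (u / 2) - ρ (4 * u) = 0 := by
  rcases h with h | h
  · rw [hρ1, hρ1, sub_self]
    · rw [abs_mul]; norm_num; linarith
    · rw [abs_div]; norm_num; linarith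
  · have hz : ∀ s : ℝ, 2 ≤ |s| → ρ s = 0 := by
      intro s hs
      by_contra hc
      have := abs_lt.2 (hρsupp hc)
      linarith
    rw [hz, hz, sub_self]
    · rw [abs_mul]; norm_num; linarith
    · rw [abs_div]; norm_num; linarith

lemma hpA_zero {γ : ℝ} {ρ : ℝ → ℝ} (hρsupp : Function.support ρ ⊆ Set.Ioo (-2) 2)
    (hρ1 : ∀ s : ℝ, |s| ≤ 1 → ρ s = 1) (j : ℕ) {q : hpQ} (h : |q.2| ≤ 1 / 4 ∨ 4 ≤ |q.2|) :
    hpA γ ρ j q = 0 := by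
  simp [hpA, hp_chi_zero hρsupp hρ1 h]

lemma hpA_left {γ : ℝ} {ρ : ℝ → ℝ} (hρsupp : Function.support ρ ⊆ Set.Ioo (-2) 2)
    (hρ1 : ∀ s : ℝ, |s| ≤ 1 → ρ s = 1) (j : ℕ) (p : ℝ × ℝ × ℝ) :
    hpA γ ρ j =ᶠ[𝓝 (p, 1 / 8)] 0 := by
  have : ∀ᶠ q : hpQ in 𝓝 (p, 1 / 8), |q.2| < 1 / 4 := by
    apply ContinuousAt.eventually_lt (by fun_prop) (by fun_prop)
    norm_num [abs_of_pos]
  filter_upwards [this] with q hq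
  exact hpA_zero hρsupp hρ1 j (Or.inl hq.le)

lemma hpA_right {γ : ℝ} {ρ : ℝ → ℝ} (hρsupp : Function.support ρ ⊆ Set.Ioo (-2) 2)
    (hρ1 : ∀ s : ℝ, |s| ≤ 1 → ρ s = 1) (j : ℕ) (p : ℝ × ℝ × ℝ) :
    hpA γ ρ j =ᶠ[𝓝 (p, 8)] 0 := by
  have : ∀ᶠ q : hpQ in 𝓝 (p, 8), 4 < |q.2| := by
    apply ContinuousAt.eventually_lt (by fun_prop) (by fun_prop)
    norm_num [abs_of_pos]
  filter_upwards [this] with q hq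
  exact hpA_zero hρsupp hρ1 j (Or.inr hq.le)

lemma hpφ_deriv (p : ℝ × ℝ × ℝ) {u : ℝ} (hu : 0 < u) :
    HasDerivAt (fun v => hpφ (p, v)) (u / hpφ (p, u)) u := by
  have h1 : HasDerivAt (fun y : ℝ => p.1 ^ 2 + y ^ 2) (2 * u) u := by
    refine ((hasDerivAt_id' u).fun_pow 2).const_add (p.1 ^ 2) |>.congr_deriv ?_
    simp
  have := (h1.sqrt (by positivity))
  refine this.congr_deriv ?_
  simp only [hpφ]
  have hs : Real.sqrt (p.1 ^ 2 + u ^ 2) ≠ 0 := (Real.sqrt_pos.2 (by positivity)).ne'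
  field_simp

lemma hpφ_deriv2 (p : ℝ × ℝ × ℝ) {u : ℝ} (hu : 0 < u) :
    HasDerivAt (fun v => v / hpφ (p, v)) (p.1 ^ 2 / hpφ (p, u) ^ 3) u := by
  have h0 := hpφ_pos (q := (p, u)) hu
  refine ((hasDerivAt_id' u).fun_div (hpφ_deriv p hu) h0.ne').congr_deriv ?_
  have h2 : hpφ (p, u) ^ 2 = p.1 ^ 2 + u ^ 2 := Real.sq_sqrt (by positivity)
  have : p.1 ^ 2 = hpφ (p, u) ^ 2 - u ^ 2 := by rw [h2]; ring
  rw [this]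
  field_simp

lemma hpΘ_deriv (p : ℝ × ℝ × ℝ) {u : ℝ} (hu : 0 < u) :
    hpDu hpΘ (p, u) = p.2.1 + p.2.2 * (u / hpφ (p, u)) := by
  have h1 := hpDu_hasDeriv (hpΘ_smooth (q := (p, u)) hu)
  have h2 : HasDerivAt (fun v => hpΘ (p, v)) (p.2.1 + p.2.2 * (u / hpφ (p, u))) u := by
    refine (((hasDerivAt_id' u).const_mul p.2.1).fun_add
      ((hpφ_deriv p hu).const_mul p.2.2)).congr_deriv ?_
    simp
  exact h1.unique h2

lemma hp_ratio_le (p : ℝ × ℝ × ℝ) {u : ℝ} (hu : 0 < u) : u / hpφ (p, u) ≤ 1 := by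
  rw [div_le_one (hpφ_pos (q := (p, u)) hu)]
  apply Real.le_sqrt_of_sq_le
  simp only
  nlinarith [sq_nonneg p.1]

lemma hp_ratio_ge (p : ℝ × ℝ × ℝ) {u : ℝ} (hp : p.1 ∈ Set.Icc (0 : ℝ) (1 / 2))
    (hu : 1 / 8 ≤ u) : 1 / 5 ≤ u / hpφ (p, u) := by
  have hu0 : 0 < u := by linarith
  rw [div_le_div_iff₀ (by norm_num) (hpφ_pos (q := (p, u)) hu0), one_mul]
  apply Real.sqrt_le_iff.2 ⟨by positivity, ?_⟩
  simp only
  have := hp.1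
  have := hp.2
  nlinarith

/-- The one-dimensional oscillatory integral. -/
def hpM (γ : ℝ) (ρ : ℝ → ℝ) (j : ℕ) (ε a τ : ℝ) : ℂ :=
  ∫ u in (1 / 8 : ℝ)..8, Complex.exp (I * ((hpΘ ((ε, a, τ), u) : ℝ) : ℂ)) *
    ((hpA γ ρ j ((ε, 0, 0), u) : ℝ) : ℂ)

lemma hpM_scale (γ : ℝ) (ρ : ℝ → ℝ) (j : ℕ) (ε a τ T : ℝ) (hT : T ≠ 0) :
    hpM γ ρ j ε a τ = ∫ u in (1 / 8 : ℝ)..8,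
      Complex.exp (I * ((T * hpΘ ((ε, a / T, τ / T), u) : ℝ) : ℂ)) *
        ((hpA γ ρ j ((ε, a / T, τ / T), u) : ℝ) : ℂ) := by
  unfold hpM
  congr 1
  funext u
  have : hpΘ ((ε, a, τ), u) = T * hpΘ ((ε, a / T, τ / T), u) := by
    simp only [hpΘ, hpφ]; field_simp
  rw [this]
  rfl

section
lemma hpM_triv {γ : ℝ} {ρ : ℝ → ℝ} (hρ : ContDiff ℝ (⊤ : ℕ∞) ρ) (j : ℕ) : ∃ C : ℝ, 0 ≤ C ∧ ∀ ε ∈ Set.Icc (0 : ℝ) (1 / 2), ∀ a τ : ℝ,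
    ‖hpM γ ρ j ε a τ‖ ≤ C := by
  obtain ⟨C, hC0, hC⟩ := hp_bound (A := hpA γ ρ j) (α := 1 / 8) (β := 8)
    (P := (Set.Icc (0 : ℝ) (1 / 2)) ×ˢ {((0 : ℝ), (0 : ℝ))})
    (isCompact_Icc.prod isCompact_singleton)
    (fun p _ u hu => hpA_smooth hρ j (by simp only; linarith [hu.1]))
  refine ⟨C * (8 - 1 / 8), by positivity, fun ε hε a τ => ?_⟩
  exact hp_norm_le (by norm_num) _ _ (hC (ε, 0, 0) ⟨hε, rfl⟩)

lemma hpM_ns {γ : ℝ} {ρ : ℝ → ℝ} (hρ : ContDiff ℝ (⊤ : ℕ∞) ρ)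
    (hρsupp : Function.support ρ ⊆ Set.Ioo (-2) 2) (hρ1 : ∀ s : ℝ, |s| ≤ 1 → ρ s = 1) (j : ℕ)
    {P : Set (ℝ × ℝ)} (hP : IsCompact P)
    (h0 : ∀ p ∈ P, ∀ r : ℝ, 1 / 5 ≤ r → r ≤ 1 → p.1 + p.2 * r ≠ 0) :
    ∃ C : ℝ, 0 ≤ C ∧ ∀ ε ∈ Set.Icc (0 : ℝ) (1 / 2), ∀ a τ T : ℝ, 0 < T → (a / T, τ / T) ∈ P →
    ‖hpM γ ρ j ε a τ‖ ≤ C / T ^ 2 := by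
  obtain ⟨C, hC0, hC⟩ := hp_nonstat (Θ := hpΘ) (A := hpA γ ρ j) (α := 1 / 8) (β := 8)
    (P := (Set.Icc (0 : ℝ) (1 / 2)) ×ˢ P)
    (isCompact_Icc.prod hP) (by norm_num)
    (fun p _ u hu => hpA_smooth hρ j (by simp only; linarith [hu.1]))
    (fun p _ u hu => hpΘ_smooth (by simp only; linarith [hu.1]))
    (fun p hp u hu => by
      have hu0 : 0 < u := by linarith [hu.1]
      rw [hpΘ_deriv p hu0]
      exact h0 p.2 hp.2 _ (hp_ratio_ge p hp.1 hu.1) (hp_ratio_le p hu0))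
    (fun p _ => hpA_left hρsupp hρ1 j p) (fun p _ => hpA_right hρsupp hρ1 j p)
  refine ⟨C, hC0, fun ε hε a τ T hT hm => ?_⟩
  rw [hpM_scale γ ρ j ε a τ T hT.ne']
  exact hC (ε, a / T, τ / T) ⟨hε, hm⟩ T hT

lemma hpM_small {γ : ℝ} {ρ : ℝ → ℝ} (hρ : ContDiff ℝ (⊤ : ℕ∞) ρ)
    (hρsupp : Function.support ρ ⊆ Set.Ioo (-2) 2) (hρ1 : ∀ s : ℝ, |s| ≤ 1 → ρ s = 1) (j : ℕ)
    : ∃ C : ℝ, 0 ≤ C ∧ ∀ ε ∈ Set.Icc (0 : ℝ) (1 / 2), ∀ a τ : ℝ, τ ≠ 0 →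
    |a| ≤ |τ| / 8 → ‖hpM γ ρ j ε a τ‖ ≤ C / τ ^ 2 := by
  obtain ⟨C, hC0, hC⟩ := hpM_ns (γ := γ) hρ hρsupp hρ1 j
    (P := Set.Icc (-(1 / 8) : ℝ) (1 / 8) ×ˢ ({1, -1} : Set ℝ))
    (isCompact_Icc.prod (Set.toFinite _).isCompact) (by
      rintro ⟨b, c⟩ ⟨⟨h1, h2⟩, h3⟩ r hr1 hr2
      simp only at h1 h2
      rcases h3 with h3 | h3
      · simp only at h3 ⊢
        subst h3; intro h; linarith
      · have h3 : c = -1 := h3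
        subst h3; intro h; simp only at h; linarith)
  refine ⟨C, hC0, fun ε hε a τ hτ ha => ?_⟩
  have hτ' : 0 < |τ| := abs_pos.2 hτ
  have := hC ε hε a τ |τ| hτ' ⟨?_, ?_⟩
  · rwa [sq_abs] at this
  · rw [Set.mem_Icc, ← abs_le, abs_div, abs_abs, div_le_iff₀ hτ']
    linarith
  · rcases lt_or_gt_of_ne hτ with h | h
    · right; simp only [abs_of_neg h, Set.mem_singleton_iff]; field_simp
    · left; simp only [abs_of_pos h]; field_simp

lemma hpM_big {γ : ℝ} {ρ : ℝ → ℝ} (hρ : ContDiff ℝ (⊤ : ℕ∞) ρ)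
    (hρsupp : Function.support ρ ⊆ Set.Ioo (-2) 2) (hρ1 : ∀ s : ℝ, |s| ≤ 1 → ρ s = 1) (j : ℕ)
    : ∃ C : ℝ, 0 ≤ C ∧ ∀ ε ∈ Set.Icc (0 : ℝ) (1 / 2), ∀ a τ : ℝ, a ≠ 0 →
    |τ| ≤ |a| / 2 → ‖hpM γ ρ j ε a τ‖ ≤ C / a ^ 2 := by
  obtain ⟨C, hC0, hC⟩ := hpM_ns (γ := γ) hρ hρsupp hρ1 j
    (P := ({1, -1} : Set ℝ) ×ˢ Set.Icc (-(1 / 2) : ℝ) (1 / 2))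
    ((Set.toFinite _).isCompact.prod isCompact_Icc) (by
      rintro ⟨b, c⟩ ⟨h3, ⟨h1, h2⟩⟩ r hr1 hr2
      simp only at h1 h2
      rcases h3 with h3 | h3
      · simp only at h3 ⊢
        subst h3; intro h; nlinarith
      · have h3 : b = -1 := h3
        subst h3; intro h; simp only at h; nlinarith)
  refine ⟨C, hC0, fun ε hε a τ ha hτ => ?_⟩
  have ha' : 0 < |a| := abs_pos.2 ha
  have := hC ε hε a τ |a| ha' ⟨?_, ?_⟩
  · rwa [sq_abs] at this
  · rcases lt_or_gt_of_ne ha with h | h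
    · right; simp only [abs_of_neg h, Set.mem_singleton_iff]; field_simp
    · left; simp only [abs_of_pos h]; field_simp
  · rw [Set.mem_Icc, ← abs_le, abs_div, abs_abs, div_le_iff₀ ha']
    linarith

lemma hpM_conj {γ : ℝ} {ρ : ℝ → ℝ} (j : ℕ) (ε a τ : ℝ) : ‖hpM γ ρ j ε a τ‖ = ‖hpM γ ρ j ε (-a) (-τ)‖ := by
  have : hpM γ ρ j ε (-a) (-τ) = (starRingEnd ℂ) (hpM γ ρ j ε a τ) := by
    unfold hpM
    rw [intervalIntegral.integral_of_le (by norm_num), intervalIntegral.integral_of_le (by norm_num),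
      ← integral_conj]
    congr 1
    funext u
    rw [map_mul, Complex.conj_ofReal, ← Complex.exp_conj, map_mul, Complex.conj_ofReal,
      Complex.conj_I]
    congr 2
    simp only [hpΘ, hpφ]
    push_cast
    ring
  rw [this]
  simp

lemma hpM_vdc {γ : ℝ} {ρ : ℝ → ℝ} (hρ : ContDiff ℝ (⊤ : ℕ∞) ρ)
    (hρsupp : Function.support ρ ⊆ Set.Ioo (-2) 2) (hρ1 : ∀ s : ℝ, |s| ≤ 1 → ρ s = 1) (j : ℕ)
    : ∃ C : ℝ, 0 ≤ C ∧ ∀ ε ∈ Set.Ioc (0 : ℝ) (1 / 2), ∀ a τ : ℝ, τ ≠ 0 →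
    ‖hpM γ ρ j ε a τ‖ ≤ C * ε⁻¹ / Real.sqrt |τ| := by
  have hP : IsCompact ((Set.Icc (0 : ℝ) (1 / 2)) ×ˢ {((0 : ℝ), (0 : ℝ))}) :=
    isCompact_Icc.prod isCompact_singleton
  obtain ⟨C1, hC10, hC1⟩ := hp_bound (A := hpA γ ρ j) (α := 1 / 8) (β := 8) hP
    (fun p _ u hu => hpA_smooth hρ j (by simp only; linarith [hu.1]))
  obtain ⟨C2, hC20, hC2⟩ := hp_bound (A := hpDu (hpA γ ρ j)) (α := 1 / 8) (β := 8) hP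
    (fun p _ u hu => hpDu_smooth (hpA_smooth hρ j (by simp only; linarith [hu.1])))
  have hpos : ∀ ε ∈ Set.Ioc (0 : ℝ) (1 / 2), ∀ a τ : ℝ, 0 < τ →
    ‖hpM γ ρ j ε a τ‖ ≤ ((2 * Real.pi + (8 - 1 / 8)) * (C1 + C2) * 27) * ε⁻¹ / Real.sqrt τ := by
    intro ε hε a τ hτ
    have hε' : ((ε, 0, 0) : ℝ × ℝ × ℝ) ∈ ((Set.Icc (0 : ℝ) (1 / 2)) ×ˢ {((0 : ℝ), (0 : ℝ))}) :=
      ⟨⟨hε.1.le, hε.2⟩, rfl⟩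
    have hε0 := hε.1
    have h := hp_vdc2 (α := 1 / 8) (β := 8) (by norm_num) (fun u => hpΘ ((ε, a, τ), u))
      (fun u => a + τ * (u / hpφ ((ε, a, τ), u)))
      (fun u => τ * (ε ^ 2 / hpφ ((ε, a, τ), u) ^ 3))
      (fun u => hpA γ ρ j ((ε, 0, 0), u)) (fun u => hpDu (hpA γ ρ j) ((ε, 0, 0), u))
      (μ := τ * ε ^ 2 / 729) (G := C1 + C2) (by positivity)
      (fun u hu => by
        have hu0 : 0 < u := by linarith [hu.1]
        have h1 := hpDu_hasDeriv (hpΘ_smooth (q := ((ε, a, τ), u)) hu0)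
        rwa [hpΘ_deriv _ hu0] at h1)
      (fun u hu => by
        have hu0 : 0 < u := by linarith [hu.1]
        exact ((hpφ_deriv2 (ε, a, τ) hu0).const_mul τ).const_add a)
      (by
        intro u hu
        have hu0 : 0 < u := by linarith [hu.1]
        have h1 := (hpφ_deriv (ε, a, τ) hu0).continuousAt
        have h2 := hpφ_pos (q := ((ε, a, τ), u)) hu0
        refine ContinuousAt.continuousWithinAt ?_
        exact continuousAt_const.mul (continuousAt_const.div (h1.pow 3) (pow_pos h2 3).ne'))
      (fun u hu => hpDu_hasDeriv (hpA_smooth hρ j (by simp only; linarith [hu.1])))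
      (hp_cont fun u hu => hpDu_smooth (hpA_smooth hρ j (by simp only; linarith [hu.1])))
      (fun u hu => by
        have hu0 : 0 < u := by linarith [hu.1]
        have h2 := hpφ_pos (q := ((ε, a, τ), u)) hu0
        have h3 : hpφ ((ε, a, τ), u) ≤ 9 := by
          apply Real.sqrt_le_iff.2 ⟨by norm_num, ?_⟩
          simp only
          nlinarith [hε.1, hε.2, hu.1, hu.2]
        have h4 : hpφ ((ε, a, τ), u) ^ 3 ≤ 729 := by
          calc _ ≤ (9:ℝ) ^ 3 := by gcongr
            _ = 729 := by norm_num
        rw [mul_div_assoc]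
        gcongr)
      (fun u hu => (hC1 _ hε' u hu).trans (by linarith))
      (fun u hu => (hC2 _ hε' u hu).trans (by linarith))
      (hpA_left hρsupp hρ1 j _).eq_of_nhds (hpA_right hρsupp hρ1 j _).eq_of_nhds
    refine h.trans (le_of_eq ?_)
    have : Real.sqrt (τ * ε ^ 2 / 729) = Real.sqrt τ * ε / 27 := by
      rw [Real.sqrt_div (by positivity), Real.sqrt_mul hτ.le, Real.sqrt_sq hε0.le]
      congr 1
      rw [show (729 : ℝ) = 27 ^ 2 by norm_num, Real.sqrt_sq (by norm_num)]
    rw [this]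
    have : 0 < Real.sqrt τ := Real.sqrt_pos.2 hτ
    field_simp
  refine ⟨(2 * Real.pi + (8 - 1 / 8)) * (C1 + C2) * 27, ?_, fun ε hε a τ hτ => ?_⟩
  · have : (0 : ℝ) ≤ 8 - 1 / 8 := by norm_num
    positivity
  · rcases lt_or_gt_of_ne hτ with h | h
    · rw [hpM_conj, abs_of_neg h]
      exact hpos ε hε _ _ (by linarith)
    · rw [abs_of_pos h]
      exact hpos ε hε _ _ h

end


lemma hpφ_cont (p : ℝ × ℝ × ℝ) : Continuous (fun u : ℝ => hpφ (p, u)) := by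
  unfold hpφ; fun_prop

lemma hpA_cont {γ : ℝ} {ρ : ℝ → ℝ} (hρ : Continuous ρ) (j : ℕ) (p : ℝ × ℝ × ℝ) (hp : 0 < p.1) :
    Continuous (fun u : ℝ => hpA γ ρ j (p, u)) := by
  have h : ∀ u : ℝ, hpφ (p, u) ≠ 0 := fun u => (Real.sqrt_pos.2 (by positivity)).ne'
  have h1 : Continuous (fun u : ℝ => hpφ (p, u) ^ (-γ)) :=
    (hpφ_cont p).rpow_const (fun u => Or.inl (h u))
  unfold hpA
  fun_prop

def hpN (γ : ℝ) (ρ : ℝ → ℝ) (ε a τ : ℝ) : ℂ :=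
  ∫ u in (1 / 8 : ℝ)..8, Complex.exp (I * ((τ * hpφ ((ε, 0, 0), u) : ℝ) : ℂ)) *
    ((hpA γ ρ 1 ((ε, 0, 0), u) : ℝ) : ℂ) * ∫ z in (-u)..u, Complex.exp (I * ((a * z : ℝ) : ℂ))

lemma hpN_one {γ : ℝ} {ρ : ℝ → ℝ} (hρ : Continuous ρ) {ε a : ℝ} (τ : ℝ) (hε : 0 < ε)
    (ha : 0 < a) :
    ‖hpN γ ρ ε a τ‖ ≤ (‖hpM γ ρ 1 ε a τ‖ + ‖hpM γ ρ 1 ε (-a) τ‖) / a := by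
  have hc : (I * (a : ℂ)) ≠ 0 := mul_ne_zero I_ne_zero (by exact_mod_cast ha.ne')
  have key : hpN γ ρ ε a τ = (hpM γ ρ 1 ε a τ - hpM γ ρ 1 ε (-a) τ) / (I * a) := by
    have hA := hpA_cont (γ := γ) hρ 1 (ε, 0, 0) hε
    have hφ := hpφ_cont (ε, 0, 0)
    have hII : ∀ b : ℝ, IntervalIntegrable (fun u : ℝ =>
        Complex.exp (I * ((hpΘ ((ε, b, τ), u) : ℝ) : ℂ)) * ((hpA γ ρ 1 ((ε, 0, 0), u) : ℝ) : ℂ))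
        volume (1 / 8) 8 := by
      intro b
      apply Continuous.intervalIntegrable
      have : Continuous (fun u : ℝ => hpΘ ((ε, b, τ), u)) := by
        have := hpφ_cont (ε, b, τ)
        unfold hpΘ
        fun_prop
      fun_prop
    unfold hpM
    rw [← intervalIntegral.integral_sub (hII _) (hII _), ← intervalIntegral.integral_div]
    unfold hpN
    congr 1
    funext u
    have h1 : ∫ z in (-u)..u, Complex.exp (I * ((a * z : ℝ) : ℂ)) =
        (Complex.exp (I * a * u) - Complex.exp (I * a * (-u : ℝ))) / (I * a) := by
      rw [← integral_exp_mul_complex hc]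
      congr 1
      funext z
      push_cast
      ring_nf
    rw [h1]
    have h2 : ∀ b : ℝ, Complex.exp (I * ((hpΘ ((ε, b, τ), u) : ℝ) : ℂ)) =
        Complex.exp (I * ((τ * hpφ ((ε, 0, 0), u) : ℝ) : ℂ)) * Complex.exp (I * b * u) := by
      intro b
      rw [← Complex.exp_add]
      congr 1
      have : hpφ ((ε, b, τ), u) = hpφ ((ε, 0, 0), u) := rfl
      simp only [hpΘ, this]
      push_cast
      ring
    rw [h2, h2]
    have h3 : I * (a : ℂ) * ((-u : ℝ) : ℂ) = I * ((-a : ℝ) : ℂ) * u := by push_cast; ring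
    rw [h3]
    ring
  rw [key, norm_div, norm_mul, Complex.norm_I, one_mul, Complex.norm_real, Real.norm_of_nonneg ha.le]
  gcongr
  exact norm_sub_le _ _

lemma hpN_two {γ : ℝ} {ρ : ℝ → ℝ} (hρ : Continuous ρ) {ε a τ C : ℝ} (hε : 0 < ε) (ha : 0 ≤ a)
    (hC : ∀ b : ℝ, |b| ≤ a → ‖hpM γ ρ 2 ε b τ‖ ≤ C) :
    ‖hpN γ ρ ε a τ‖ ≤ C * 2 := by
  have hA := hpA_cont (γ := γ) hρ 1 (ε, 0, 0) hε
  have hφ := hpφ_cont (ε, 0, 0)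
  have key : hpN γ ρ ε a τ = ∫ s in (-1 : ℝ)..1, hpM γ ρ 2 ε (a * s) τ := by
    have h1 : hpN γ ρ ε a τ = ∫ u in (1 / 8 : ℝ)..8, ∫ s in (-1 : ℝ)..1,
        Complex.exp (I * ((hpΘ ((ε, a * s, τ), u) : ℝ) : ℂ)) *
          ((hpA γ ρ 2 ((ε, 0, 0), u) : ℝ) : ℂ) := by
      unfold hpN
      congr 1
      funext u
      have h2 : ∫ z in (-u)..u, Complex.exp (I * ((a * z : ℝ) : ℂ)) =
          u * ∫ s in (-1 : ℝ)..1, Complex.exp (I * ((a * (u * s) : ℝ) : ℂ)) := by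
        have := intervalIntegral.smul_integral_comp_mul_left (a := -1) (b := 1)
          (fun z : ℝ => Complex.exp (I * ((a * z : ℝ) : ℂ))) u
        rw [Complex.real_smul] at this
        rw [this]; simp
      rw [h2, ← mul_assoc, ← intervalIntegral.integral_const_mul]
      congr 1
      funext s
      have h3 : Complex.exp (I * ((hpΘ ((ε, a * s, τ), u) : ℝ) : ℂ)) =
        Complex.exp (I * ((τ * hpφ ((ε, 0, 0), u) : ℝ) : ℂ)) *
          Complex.exp (I * ((a * (u * s) : ℝ) : ℂ)) := by
        rw [← Complex.exp_add]
        congr 1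
        have : hpφ ((ε, a * s, τ), u) = hpφ ((ε, 0, 0), u) := rfl
        simp only [hpΘ, this]
        push_cast
        ring
      have h4 : hpA γ ρ 2 ((ε, 0, 0), u) = u * hpA γ ρ 1 ((ε, 0, 0), u) := by
        simp only [hpA]; ring
      rw [h3, h4]
      push_cast
      ring
    rw [h1]
    unfold hpM
    apply intervalIntegral_intervalIntegral_swap
    apply Integrable.mono_measure (ν := (volume : Measure (ℝ × ℝ)).restrict
      (Set.Icc (1 / 8 : ℝ) 8 ×ˢ Set.Icc (-1 : ℝ) 1)) _ (by
        apply Measure.restrict_mono _ le_rfl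
        rw [Set.uIoc_of_le (by norm_num), Set.uIoc_of_le (by norm_num)]
        exact Set.prod_mono Set.Ioc_subset_Icc_self Set.Ioc_subset_Icc_self)
    refine ContinuousOn.integrableOn_compact (isCompact_Icc.prod isCompact_Icc)
      (Continuous.continuousOn ?_)
    have hA := hpA_cont (γ := γ) hρ 2 (ε, 0, 0) hε
    have : Continuous (fun p : ℝ × ℝ => hpΘ ((ε, a * p.2, τ), p.1)) := by
      unfold hpΘ hpφ
      fun_prop
    have h5 : Continuous (fun p : ℝ × ℝ => hpA γ ρ 2 ((ε, 0, 0), p.1)) :=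
      hA.comp continuous_fst
    fun_prop
  rw [key]
  have := intervalIntegral.norm_integral_le_of_norm_le_const (a := -1) (b := 1) (C := C)
    (f := fun s => hpM γ ρ 2 ε (a * s) τ) (fun s hs => by
      rw [Set.uIoc_of_le (by norm_num)] at hs
      apply hC
      rw [abs_mul, abs_of_nonneg ha]
      have : |s| ≤ 1 := abs_le.2 ⟨hs.1.le, hs.2⟩
      nlinarith)
  norm_num at this
  exact this


lemma hp_fin_a {W L E e : ℝ} (hL : 1 ≤ L) (he : 1 ≤ e) (_hE : 0 ≤ E) (h1 : W ≤ E / L)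
    (h2 : W ≤ E * e / (L * √L)) :
    W ≤ (E + 1) * L⁻¹ * min 1 (e * L ^ (-(1 / 2) : ℝ)) := by
  have hL0 : 0 < L := by linarith
  have hr : L ^ (-(1 / 2) : ℝ) = (√L)⁻¹ := by
    rw [Real.rpow_neg hL0.le, ← Real.sqrt_eq_rpow]
  have hs : 0 < √L := Real.sqrt_pos.2 hL0
  rw [hr]
  rcases min_cases 1 (e * (√L)⁻¹) with ⟨h, _⟩ | ⟨h, _⟩
  · rw [h, mul_one]
    refine h1.trans ?_
    rw [div_eq_mul_inv]
    gcongr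
    linarith
  · rw [h]
    refine h2.trans ?_
    have : E * e / (L * √L) = E * L⁻¹ * (e * (√L)⁻¹) := by field_simp
    rw [this]
    gcongr
    linarith

lemma hp_fin_b {W L E e : ℝ} (hL : 1 ≤ L) (he : 1 ≤ e) (hE : 0 ≤ E) (h1 : W ≤ E / L ^ 2) :
    W ≤ E / L ∧ W ≤ E * e / (L * √L) := by
  have hL0 : 0 < L := by linarith
  have hs : 0 < √L := Real.sqrt_pos.2 hL0
  have hsL : √L ≤ L := by rw [Real.sqrt_le_left hL0.le]; nlinarith
  constructor
  · refine h1.trans ?_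
    gcongr
    nlinarith
  · refine h1.trans ?_
    have : E ≤ E * e := by nlinarith
    gcongr
    nlinarith

lemma hpN_bound {γ : ℝ} {ρ : ℝ → ℝ} (hρ : ContDiff ℝ (⊤ : ℕ∞) ρ)
    (hρsupp : Function.support ρ ⊆ Set.Ioo (-2) 2) (hρ1 : ∀ s : ℝ, |s| ≤ 1 → ρ s = 1) :
    ∃ C : ℝ, 0 < C ∧ ∀ ε ∈ Set.Ioc (0 : ℝ) (1 / 2), ∀ a τ : ℝ, 0 ≤ a →
      ‖hpN γ ρ ε a τ‖ ≤ C * (1 + √(a ^ 2 + τ ^ 2))⁻¹ *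
        min 1 (ε⁻¹ * (1 + √(a ^ 2 + τ ^ 2)) ^ (-(1 / 2) : ℝ)) := by
  obtain ⟨C0, h00, h0⟩ := hpM_triv (γ := γ) hρ 2
  obtain ⟨C1, h10, h1⟩ := hpM_triv (γ := γ) hρ 1
  obtain ⟨C2, h20, h2⟩ := hpM_small (γ := γ) hρ hρsupp hρ1 2
  obtain ⟨C3, h30, h3⟩ := hpM_big (γ := γ) hρ hρsupp hρ1 1
  obtain ⟨C4, h40, h4⟩ := hpM_vdc (γ := γ) hρ hρsupp hρ1 1
  set E := 8 * C0 + 36 * C1 + 32 * C2 + 64 * C3 + 108 * C4 with hE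
  have hE0 : 0 ≤ E := by positivity
  refine ⟨E + 1, by positivity, fun ε hε a τ ha => ?_⟩
  have hεI : ε ∈ Set.Icc (0 : ℝ) (1 / 2) := ⟨hε.1.le, hε.2⟩
  have hc := hρ.continuous
  set m := √(a ^ 2 + τ ^ 2) with hm
  have hm0 : 0 ≤ m := Real.sqrt_nonneg _
  have hmsq : m ^ 2 = a ^ 2 + τ ^ 2 := Real.sq_sqrt (by positivity)
  have he : 1 ≤ ε⁻¹ := (one_le_inv₀ hε.1).2 (by linarith [hε.2])
  set L := 1 + m with hLdef
  have hL : 1 ≤ L := by linarith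
  have hL0 : 0 < L := by linarith
  have hts : |τ| ^ 2 = τ ^ 2 := sq_abs τ
  have ht0 := abs_nonneg τ
  suffices h : ‖hpN γ ρ ε a τ‖ ≤ E / L ∧ ‖hpN γ ρ ε a τ‖ ≤ E * ε⁻¹ / (L * √L) from
    hp_fin_a hL he hE0 h.1 h.2
  rcases le_total m 1 with hm1 | hm1
  · apply hp_fin_b hL he hE0
    have := hpN_two hc hε.1 ha (fun b _ => h0 ε hεI b τ)
    refine this.trans ?_
    rw [le_div_iff₀ (by positivity)]
    have : L ^ 2 ≤ 4 := by nlinarith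
    nlinarith
  by_cases hs : a ≤ |τ| / 8
  · apply hp_fin_b hL he hE0
    have hmt : m ≤ 2 * |τ| := abs_le_of_sq_le_sq' (by nlinarith) (by positivity) |>.2
    have htp : 0 < |τ| := by linarith
    have ht : τ ≠ 0 := abs_pos.1 htp
    have := hpN_two hc hε.1 ha (fun b hb => h2 ε hεI b τ ht (hb.trans hs))
    refine this.trans ?_
    rw [← hts]
    have h5 : L ≤ 4 * |τ| := by linarith
    have h6 : L ^ 2 ≤ 16 * |τ| ^ 2 := by nlinarith
    rw [le_div_iff₀ (by positivity), div_mul_eq_mul_div, div_mul_eq_mul_div,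
      div_le_iff₀ (by positivity)]
    have : C2 * 2 * L ^ 2 ≤ C2 * 2 * (16 * |τ| ^ 2) := by gcongr
    have h7 : 32 * C2 * |τ| ^ 2 ≤ E * |τ| ^ 2 := by gcongr; linarith
    linarith
  push Not at hs
  have hap : 0 < a := by linarith
  have hN := hpN_one (γ := γ) hc τ hε.1 hap
  by_cases hb : |τ| ≤ a / 2
  · apply hp_fin_b hL he hE0
    have hma : m ≤ 2 * a := abs_le_of_sq_le_sq' (by nlinarith) (by positivity) |>.2
    have h5 : L ≤ 4 * a := by linarith
    have h6 : L ^ 2 ≤ 16 * a ^ 2 := by nlinarith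
    have b1 := h3 ε hεI a τ hap.ne' (by rwa [abs_of_pos hap])
    have b2 := h3 ε hεI (-a) τ (by linarith) (by rwa [abs_neg, abs_of_pos hap])
    rw [neg_sq] at b2
    refine hN.trans ?_
    have h8 : (‖hpM γ ρ 1 ε a τ‖ + ‖hpM γ ρ 1 ε (-a) τ‖) / a ≤ (C3 / a ^ 2 + C3 / a ^ 2) / a := by
      gcongr
    refine h8.trans ?_
    have h9 : (C3 / a ^ 2 + C3 / a ^ 2) / a ≤ (C3 / a ^ 2 + C3 / a ^ 2) / (1 / 2) := by
      gcongr
      linarith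
    refine h9.trans ?_
    have h10' : (C3 / a ^ 2 + C3 / a ^ 2) / (1 / 2) = 4 * C3 / a ^ 2 := by ring
    rw [h10', div_le_div_iff₀ (by positivity) (by positivity)]
    have : 4 * C3 * L ^ 2 ≤ 4 * C3 * (16 * a ^ 2) := by gcongr
    have h7 : 64 * C3 * a ^ 2 ≤ E * a ^ 2 := by gcongr; linarith
    linarith
  push Not at hb
  have htp : 0 < |τ| := by linarith
  have ht : τ ≠ 0 := abs_pos.1 htp
  have hma : m ≤ 9 * a := abs_le_of_sq_le_sq' (by nlinarith) (by positivity) |>.2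
  have hmt : m ≤ 3 * |τ| := abs_le_of_sq_le_sq' (by nlinarith) (by positivity) |>.2
  have hLa : L ≤ 18 * a := by linarith
  have hLt : L ≤ 6 * |τ| := by linarith
  constructor
  · refine hN.trans ?_
    have b1 := h1 ε hεI a τ
    have b2 := h1 ε hεI (-a) τ
    rw [div_le_div_iff₀ hap hL0]
    calc _ ≤ (C1 + C1) * (18 * a) := by gcongr
      _ = 36 * C1 * a := by ring
      _ ≤ E * a := by gcongr; linarith
  · refine hN.trans ?_
    have b1 := h4 ε hε a τ ht
    have b2 := h4 ε hε (-a) τ ht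
    have hst : 0 < √|τ| := Real.sqrt_pos.2 htp
    have hsL : √L ≤ 3 * √|τ| := by
      rw [Real.sqrt_le_left (by positivity), mul_pow, Real.sq_sqrt ht0]
      linarith
    have hε0 := hε.1
    calc _ ≤ (C4 * ε⁻¹ / √|τ| + C4 * ε⁻¹ / √|τ|) / a := by gcongr
      _ = 2 * C4 * ε⁻¹ / (a * √|τ|) := by field_simp; ring
      _ ≤ _ := by
        rw [div_le_div_iff₀ (by positivity) (by positivity)]
        calc 2 * C4 * ε⁻¹ * (L * √L) ≤ 2 * C4 * ε⁻¹ * ((18 * a) * (3 * √|τ|)) := by gcongr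
          _ = 108 * C4 * ε⁻¹ * (a * √|τ|) := by ring
          _ ≤ E * ε⁻¹ * (a * √|τ|) := by gcongr; linarith


def hpg (ρ : ℝ → ℝ) (γ : ℝ) (k : ℤ) (t r : ℝ) : ℂ :=
  Complex.exp (I * ((t * √(1 + r ^ 2) : ℝ) : ℂ)) *
    ((√(1 + r ^ 2) ^ (-γ) * (ρ ((2 : ℝ) ^ (-(k + 1)) * r) - ρ ((2 : ℝ) ^ (-(k - 2)) * r)) : ℝ) : ℂ)

lemma hpg_cont {ρ : ℝ → ℝ} (hρ : Continuous ρ) (γ : ℝ) (k : ℤ) (t : ℝ) :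
    Continuous (hpg ρ γ k t) := by
  have h : ∀ r : ℝ, √(1 + r ^ 2) ≠ 0 := fun r => (Real.sqrt_pos.2 (by positivity)).ne'
  have h1 : Continuous (fun r : ℝ => √(1 + r ^ 2) ^ (-γ)) :=
    Continuous.rpow_const (by fun_prop) (fun r => Or.inl (h r))
  unfold hpg
  fun_prop

lemma hpg_scale (ρ : ℝ → ℝ) (γ : ℝ) (k : ℤ) (t u : ℝ) :
    hpg ρ γ k t ((2 : ℝ) ^ k * u) =
      Complex.exp (I * (((2 : ℝ) ^ k * t * hpφ ((((2 : ℝ) ^ k)⁻¹, 0, 0), u) : ℝ) : ℂ)) *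
      (((((2 : ℝ) ^ k) ^ (-γ)) * (hpφ ((((2 : ℝ) ^ k)⁻¹, 0, 0), u) ^ (-γ) *
        (ρ (u / 2) - ρ (4 * u))) : ℝ) : ℂ) := by
  have hl : (0 : ℝ) < 2 ^ k := by positivity
  have h1 : √(1 + ((2 : ℝ) ^ k * u) ^ 2) = 2 ^ k * hpφ ((((2 : ℝ) ^ k)⁻¹, 0, 0), u) := by
    unfold hpφ
    rw [Real.sqrt_eq_iff_mul_self_eq (by positivity) (by positivity)]
    have := Real.mul_self_sqrt (show 0 ≤ (((2 : ℝ) ^ k)⁻¹) ^ 2 + u ^ 2 by positivity)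
    simp only
    rw [mul_mul_mul_comm, this]
    field_simp
  have h2 : (2 : ℝ) ^ (-(k + 1)) * (2 ^ k * u) = u / 2 := by
    rw [← mul_assoc, ← zpow_add₀ (by norm_num)]
    have : -(k + 1) + k = -1 := by ring
    rw [this]; norm_num; ring
  have h3 : (2 : ℝ) ^ (-(k - 2)) * (2 ^ k * u) = 4 * u := by
    rw [← mul_assoc, ← zpow_add₀ (by norm_num)]
    have : -(k - 2) + k = 2 := by ring
    rw [this]; norm_num
  have h4 : 0 ≤ hpφ ((((2 : ℝ) ^ k)⁻¹, 0, 0), u) := Real.sqrt_nonneg _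
  unfold hpg
  rw [h1, h2, h3, Real.mul_rpow hl.le h4, mul_assoc (((2 : ℝ) ^ k) ^ (-γ)),
    mul_left_comm t, ← mul_assoc ((2 : ℝ) ^ k) t]

lemma hpKloc_eq {ρ : ℝ → ℝ} (hρ : Continuous ρ)
    (hρsupp : Function.support ρ ⊆ Set.Ioo (-2) 2) (hρ1 : ∀ s : ℝ, |s| ≤ 1 → ρ s = 1)
    (γ : ℝ) (k : ℤ) (x : EuclideanSpace ℝ (Fin 3)) (t : ℝ) :
    Kloc ρ γ k x t = (2 * Real.pi : ℝ) * (((2 : ℝ) ^ k) ^ 3 * ((2 : ℝ) ^ k) ^ (-γ) : ℝ) *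
      hpN γ ρ ((2 : ℝ) ^ k)⁻¹ ((2 : ℝ) ^ k * ‖x‖) ((2 : ℝ) ^ k * t) := by
  have hl : (0 : ℝ) < 2 ^ k := by positivity
  have hg0 : ∀ u : ℝ, |u| ≤ 1 / 4 ∨ 4 ≤ |u| → hpg ρ γ k t ((2 : ℝ) ^ k * u) = 0 := by
    intro u hu
    rw [hpg_scale, hp_chi_zero hρsupp hρ1 hu]
    simp
  set F : ℝ → ℂ := fun r => hpg ρ γ k t (max r 0) with hF
  have hFpos : ∀ r, 0 ≤ r → F r = hpg ρ γ k t r := fun r hr => by simp [hF, max_eq_left hr]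
  have hFneg : ∀ r ≤ 0, F r = 0 := fun r hr => by
    have := hg0 0 (by norm_num)
    simpa [hF, max_eq_right hr] using this
  have hFbig : ∀ r, 2 ^ k * 4 ≤ r → F r = 0 := fun r hr => by
    have hr0 : 0 ≤ r := le_trans (by positivity) hr
    rw [hFpos r hr0]
    have := hg0 (r / 2 ^ k) (Or.inr (by
      rw [abs_of_nonneg (by positivity), le_div_iff₀ hl]; linarith))
    rwa [mul_div_cancel₀ _ hl.ne'] at this
  have hp := hp_polar F ((hpg_cont hρ γ k t).comp (by fun_prop)) (2 ^ k * 4) hFbig hFneg x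
  have hK : Kloc ρ γ k x t = ∫ ξ : hpE3, Complex.exp (I * (dotE x ξ : ℝ)) * F ‖ξ‖ := by
    unfold Kloc
    congr 1
    funext ξ
    rw [hFpos _ (norm_nonneg _), hpg, ← mul_assoc, ← Complex.exp_add]
    unfold jap chiLP
    congr 2
    push_cast
    ring
  rw [hK, hp, mul_assoc]
  congr 1
  set G : ℝ → ℂ := fun r => (r : ℂ) * F r * ∫ z in (-r)..r, Complex.exp (I * ((‖x‖ * z : ℝ) : ℂ))
    with hG
  have hsc := Measure.integral_comp_mul_left G ((2 : ℝ) ^ k)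
  rw [abs_of_pos (by positivity)] at hsc
  have hsc2 : ∫ r, G r = ((2 : ℝ) ^ k : ℝ) * ∫ u, G (2 ^ k * u) := by
    rw [hsc, Complex.real_smul, ← mul_assoc, ← Complex.ofReal_mul, mul_inv_cancel₀ hl.ne']
    simp
  have hres : ∫ u, G (2 ^ k * u) = ∫ u in (1 / 8 : ℝ)..8, G (2 ^ k * u) := by
    rw [intervalIntegral.integral_of_le (by norm_num)]
    symm
    apply setIntegral_eq_integral_of_forall_compl_eq_zero
    intro u hu
    have : F (2 ^ k * u) = 0 := by
      rcases le_total u 0 with h | h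
      · exact hFneg _ (mul_nonpos_of_nonneg_of_nonpos hl.le h)
      · rw [hFpos _ (by positivity)]
        apply hg0
        rw [abs_of_nonneg h]
        by_contra hc
        push Not at hc
        exact hu ⟨by linarith, by linarith⟩
    simp [hG, this]
  rw [hsc2, hres]
  unfold hpN
  rw [← intervalIntegral.integral_const_mul, ← intervalIntegral.integral_const_mul]
  apply intervalIntegral.integral_congr
  intro u hu
  rw [Set.uIcc_of_le (by norm_num)] at hu
  have hu0 : 0 ≤ u := by linarith [hu.1]
  have hin : ∫ z in (-(2 ^ k * u))..(2 ^ k * u), Complex.exp (I * ((‖x‖ * z : ℝ) : ℂ)) =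
      ((2 : ℝ) ^ k : ℝ) * ∫ z in (-u)..u, Complex.exp (I * ((2 ^ k * ‖x‖ * z : ℝ) : ℂ)) := by
    have := intervalIntegral.smul_integral_comp_mul_left (a := -u) (b := u)
      (fun z : ℝ => Complex.exp (I * ((‖x‖ * z : ℝ) : ℂ))) ((2 : ℝ) ^ k)
    rw [mul_neg, Complex.real_smul] at this
    rw [← this]
    congr 2
    funext z
    congr 3
    ring
  simp only [hG]
  rw [hin, hFpos _ (by positivity), hpg_scale]
  simp only [hpA]
  push_cast
  ring


theorem Kloc_pointwise_high (γ : ℝ) (hγ : 0 ≤ γ) (ρ : ℝ → ℝ)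
    (hρ : ContDiff ℝ (⊤ : ℕ∞) ρ) (hρsupp : Function.support ρ ⊆ Set.Ioo (-2) 2)
    (hρ1 : ∀ s : ℝ, |s| ≤ 1 → ρ s = 1) :
    ∃ C : ℝ, 0 < C ∧ ∀ k : ℤ, 1 ≤ k → ∀ (x : EuclideanSpace ℝ (Fin 3)) (t : ℝ),
      ‖Kloc ρ γ k x t‖ ≤
        C * (2 : ℝ) ^ ((k : ℝ) * (3 - γ)) * (1 + (2 : ℝ) ^ k * xtNorm x t)⁻¹ *
          min 1 ((2 : ℝ) ^ k * (1 + (2 : ℝ) ^ k * xtNorm x t) ^ (-(1 / 2) : ℝ)) := by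
  obtain ⟨C, hC0, hC⟩ := hpN_bound (γ := γ) hρ hρsupp hρ1
  refine ⟨2 * Real.pi * C, by positivity, fun k hk x t => ?_⟩
  have hl : (0 : ℝ) < 2 ^ k := by positivity
  have hl2 : (2 : ℝ) ≤ 2 ^ k := by
    calc (2 : ℝ) = 2 ^ (1 : ℤ) := by norm_num
      _ ≤ 2 ^ k := zpow_le_zpow_right₀ (by norm_num) hk
  have h := hC ((2 : ℝ) ^ k)⁻¹ ⟨by positivity, by
    rw [one_div]; exact inv_anti₀ (by norm_num) hl2⟩ (2 ^ k * ‖x‖) (2 ^ k * t) (by positivity)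
  have hm : √((2 ^ k * ‖x‖) ^ 2 + (2 ^ k * t) ^ 2) = 2 ^ k * xtNorm x t := by
    have : (2 ^ k * ‖x‖) ^ 2 + (2 ^ k * t) ^ 2 = ((2 : ℝ) ^ k) ^ 2 * (‖x‖ ^ 2 + t ^ 2) := by ring
    rw [this, Real.sqrt_mul (by positivity), Real.sqrt_sq hl.le]
    rfl
  rw [hm, inv_inv] at h
  have hpow : ((2 : ℝ) ^ k) ^ 3 * ((2 : ℝ) ^ k) ^ (-γ) = (2 : ℝ) ^ ((k : ℝ) * (3 - γ)) := by
    rw [Real.rpow_mul (by norm_num), Real.rpow_intCast, sub_eq_add_neg, Real.rpow_add hl]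
    congr 1
    exact_mod_cast (Real.rpow_natCast ((2 : ℝ) ^ k) 3).symm
  rw [hpKloc_eq hρ.continuous hρsupp hρ1, hpow, norm_mul, norm_mul, Complex.norm_real,
    Complex.norm_real, Real.norm_of_nonneg (by positivity), Real.norm_of_nonneg (by positivity)]
  calc _ ≤ 2 * Real.pi * (2 : ℝ) ^ ((k : ℝ) * (3 - γ)) * _ :=
        mul_le_mul_of_nonneg_left h (by positivity)
    _ = _ := by ring

end
end

section
/- Let r > 6, 2 ≤ q̃ < ∞, and δ ≥ 0 with δ·(q̃/2) < 1. Let h : ℝ → [0,∞) be measurable and A > 0 be such that h(t) ≤ A max{1, |t|^{−δ}} for 0 < |t| ≤ 1 and h(t) ≤ A |t|^{−1+6/r} for |t| ≥ 1. Let φ ∈ C_c^∞(ℝ) be supported in [−1,1]. Then there exists a constant C > 0 such that for all k ∈ ℝ: ‖ t ↦ h(t)φ(t−k) ‖_{L^{q̃/2}(ℝ)} ≤ C if |k| ≤ 2, and ‖ t ↦ h(t)φ(t−k) ‖_{L^{q̃/2}(ℝ)} ≤ C (|k|−1)^{−(1−6/r)} if |k| ≥ 2. -/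
open MeasureTheory Real
open scoped ENNReal NNReal

noncomputable section

lemma aux_integrable (s : ℝ) (hs : -1 < s) :
    IntegrableOn (fun t : ℝ => |t| ^ s) (Set.Icc (-3) 3) volume := by
  have h1 : IntervalIntegrable (fun t : ℝ => |t| ^ s) volume 0 3 := by
    refine (intervalIntegral.intervalIntegrable_rpow' (a := 0) (b := 3) hs).congr ?_
    intro t ht
    rw [Set.uIoc_of_le (by norm_num)] at ht
    simp only [abs_of_pos ht.1]
  have h2 : IntervalIntegrable (fun t : ℝ => |t| ^ s) volume (-3) 0 := by
    have := (IntervalIntegrable.iff_comp_neg (by simp)).1 h1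
    simpa using this.symm
  have h3 := h2.trans h1
  rwa [intervalIntegrable_iff_integrableOn_Icc_of_le (by norm_num)] at h3

lemma aux_memLp (δ p : ℝ) (hp : 1 ≤ p) (hδp : δ * p < 1) :
    MemLp (fun t : ℝ => 1 + |t| ^ (-δ)) (ENNReal.ofReal p)
      (volume.restrict (Set.Icc (-3) 3)) := by
  have hp0 : 0 < p := by linarith
  have hc : MemLp (fun _ : ℝ => (1 : ℝ)) (ENNReal.ofReal p)
      (volume.restrict (Set.Icc (-3 : ℝ) 3)) := memLp_const 1
  suffices hs : MemLp (fun t : ℝ => |t| ^ (-δ)) (ENNReal.ofReal p)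
      (volume.restrict (Set.Icc (-3 : ℝ) 3)) from hc.add hs
  have hm : Measurable (fun t : ℝ => |t| ^ (-δ)) := by fun_prop
  rw [← integrable_norm_rpow_iff hm.aestronglyMeasurable (ENNReal.ofReal_pos.2 hp0).ne' ENNReal.ofReal_ne_top]
  rw [ENNReal.toReal_ofReal hp0.le]
  have := aux_integrable (-δ * p) (by linarith)
  have he : (fun t : ℝ => ‖|t| ^ (-δ)‖ ^ p) = fun t : ℝ => |t| ^ (-δ * p) := by
    funext t
    rw [Real.norm_of_nonneg (Real.rpow_nonneg (abs_nonneg t) _),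
      ← Real.rpow_mul (abs_nonneg t)]
  rw [he]
  exact this

theorem local_time_norm_bound (r q' δ A : ℝ) (hr : 6 < r) (hq' : 2 ≤ q')
    (hδ : 0 ≤ δ) (hδq : δ * (q' / 2) < 1) (hA : 0 < A)
    (h : ℝ → ℝ) (hmeas : Measurable h) (hpos : ∀ t, 0 ≤ h t)
    (hsmall : ∀ t : ℝ, 0 < |t| → |t| ≤ 1 → h t ≤ A * max 1 (|t| ^ (-δ)))
    (hlarge : ∀ t : ℝ, 1 ≤ |t| → h t ≤ A * |t| ^ (-1 + 6 / r))
    (φ : ℝ → ℝ) (hφ : ContDiff ℝ (⊤ : ℕ∞) φ) (hφc : HasCompactSupport φ)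
    (hφsupp : Function.support φ ⊆ Set.Icc (-1) 1) :
    ∃ C : ℝ, 0 < C ∧ ∀ k : ℝ,
      (|k| ≤ 2 →
        eLpNorm (fun t => h t * φ (t - k)) (ENNReal.ofReal (q' / 2)) volume
          ≤ ENNReal.ofReal C) ∧
      (2 ≤ |k| →
        eLpNorm (fun t => h t * φ (t - k)) (ENNReal.ofReal (q' / 2)) volume
          ≤ ENNReal.ofReal (C * (|k| - 1) ^ (-(1 - 6 / r)))) := by
  set p := q' / 2 with hpdef
  have hp : 1 ≤ p := by rw [hpdef]; linarith
  have hp0 : 0 < p := by linarith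
  obtain ⟨M₀, hM₀⟩ := hφc.exists_bound_of_continuous hφ.continuous
  obtain ⟨M, hM0, hM⟩ : ∃ M : ℝ, 0 < M ∧ ∀ x, |φ x| ≤ M :=
    ⟨max M₀ 1, by positivity, fun x => (hM₀ x).trans (le_max_left _ _)⟩
  have hexp : -1 + 6 / r ≤ 0 := by
    have : 6 / r ≤ 1 := by rw [div_le_one (by linarith)]; exact hr.le
    linarith
  have hzero : ∀ t k : ℝ, t - k ∉ Set.Icc (-1 : ℝ) 1 → φ (t - k) = 0 := fun t k hh => by
    by_contra hne
    exact hh (hφsupp hne)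
  set G : ℝ → ℝ := (Set.Icc (-3 : ℝ) 3).indicator (fun t => (A * M) * (1 + |t| ^ (-δ))) with hG
  have hGm : MemLp G (ENNReal.ofReal p) volume := by
    rw [hG, memLp_indicator_iff_restrict measurableSet_Icc]
    exact (aux_memLp δ p hp hδq).const_mul (A * M)
  have hGf : eLpNorm G (ENNReal.ofReal p) volume ≠ ∞ := hGm.eLpNorm_ne_top
  set N := (eLpNorm G (ENNReal.ofReal p) volume).toReal with hN
  have hN0 : 0 ≤ N := ENNReal.toReal_nonneg
  refine ⟨2 * (A * M) + N, by positivity, fun k => ⟨fun hk => ?_, fun hk => ?_⟩⟩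
  · refine le_trans (b := ENNReal.ofReal N) ?_ (ENNReal.ofReal_le_ofReal (by nlinarith [mul_pos hA hM0]))
    rw [hN, ENNReal.ofReal_toReal hGf]
    refine eLpNorm_mono_ae_real ?_
    have hne : ∀ᵐ t : ℝ, t ≠ 0 := by simp [ae_iff]
    filter_upwards [hne] with t ht
    rw [Real.norm_eq_abs, abs_mul, abs_of_nonneg (hpos t)]
    have hpw : 0 ≤ |t| ^ (-δ) := by positivity
    by_cases hsup : t - k ∈ Set.Icc (-1 : ℝ) 1
    · have hkk := abs_le.1 hk
      have htm : t ∈ Set.Icc (-3 : ℝ) 3 := ⟨by linarith [hsup.1], by linarith [hsup.2]⟩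
      rw [hG, Set.indicator_of_mem htm]
      have hh : h t ≤ A * (1 + |t| ^ (-δ)) := by
        rcases le_total |t| 1 with h1 | h1
        · refine (hsmall t (abs_pos.2 ht) h1).trans ?_
          gcongr
          exact max_le (by linarith) (by linarith)
        · refine (hlarge t h1).trans ?_
          gcongr
          linarith [Real.rpow_le_one_of_one_le_of_nonpos h1 hexp]
      calc h t * |φ (t - k)| ≤ (A * (1 + |t| ^ (-δ))) * M := by
            gcongr
            exact hM _
        _ = _ := by ring
    · rw [hzero t k hsup, abs_zero, mul_zero, hG]
      exact Set.indicator_nonneg (fun x _ => by positivity) t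
  · have hk1 : 1 ≤ |k| - 1 := by linarith
    have hE : -(1 - 6 / r) = -1 + 6 / r := by ring
    rw [hE]
    set B := (|k| - 1) ^ (-1 + 6 / r) with hB
    have hB0 : 0 ≤ B := Real.rpow_nonneg (by linarith) _
    have hmono : eLpNorm (fun t => h t * φ (t - k)) (ENNReal.ofReal p) volume ≤
        eLpNorm ((Set.Icc (k - 1) (k + 1)).indicator fun _ => A * M * B)
          (ENNReal.ofReal p) volume := by
      refine eLpNorm_mono_real fun t => ?_
      rw [Real.norm_eq_abs, abs_mul, abs_of_nonneg (hpos t)]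
      by_cases hsup : t - k ∈ Set.Icc (-1 : ℝ) 1
      · have htm : t ∈ Set.Icc (k - 1) (k + 1) := ⟨by linarith [hsup.1], by linarith [hsup.2]⟩
        rw [Set.indicator_of_mem htm]
        have h1 : |t - k| ≤ 1 := abs_le.2 hsup
        have h2 : |k| - 1 ≤ |t| := by
          have := abs_sub_abs_le_abs_sub k t
          rw [abs_sub_comm] at this
          linarith
        have hh : h t ≤ A * B := by
          refine (hlarge t (hk1.trans h2)).trans ?_
          exact mul_le_mul_of_nonneg_left
            (Real.rpow_le_rpow_of_nonpos (by linarith) h2 hexp) hA.le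
        calc h t * |φ (t - k)| ≤ (A * B) * M := by
              gcongr
              exact hM _
          _ = _ := by ring
      · rw [hzero t k hsup, abs_zero, mul_zero]
        exact Set.indicator_nonneg (fun x _ => by positivity) t
    refine hmono.trans ((eLpNorm_indicator_const_le _ _).trans ?_)
    rw [ENNReal.toReal_ofReal hp0.le, Real.volume_Icc, show k + 1 - (k - 1) = 2 by ring]
    have hroot : (ENNReal.ofReal 2) ^ (1 / p) ≤ ENNReal.ofReal 2 := by
      conv_rhs => rw [← ENNReal.rpow_one (ENNReal.ofReal 2)]
      refine ENNReal.rpow_le_rpow_of_exponent_le (by simp) ?_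
      rw [div_le_one hp0]
      exact hp
    rw [Real.enorm_of_nonneg (by positivity)]
    refine (mul_le_mul_right hroot _).trans ?_
    rw [← ENNReal.ofReal_mul (by positivity)]
    apply ENNReal.ofReal_le_ofReal
    nlinarith [mul_nonneg hN0 hB0]

end
end

section
/- Let σ > 1, 2 ≤ q̃ ≤ ∞, 2 < q < ∞ and 6 < r ≤ r̃ < ∞ satisfy 1/q̃ + 3/r̃ > 3/2 − σ and 1/q + 3/r = 1/2. Define h(t) = ‖K_{2σ}(·,t)‖_{W(r̃/2, r/2)_x} for t ≠ 0. Then ‖ k ↦ ‖ t ↦ h(t)φ(t−k) ‖_{L^{q̃/2}(ℝ)} ‖_{L^{q/2,∞}(ℝ, dk)} < ∞. -/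
open MeasureTheory Real Complex

noncomputable section

open scoped ENNReal NNReal

/-- The `L^p` norm (with `p ∈ [1,∞]`) of an `ℝ≥0∞`-valued function. -/
def LpE {α : Type*} [MeasurableSpace α] (μ : MeasureTheory.Measure α) (p : ℝ≥0∞)
    (f : α → ℝ≥0∞) : ℝ≥0∞ :=
  if p = ∞ then essSup f μ else (∫⁻ a, f a ^ p.toReal ∂μ) ^ (1 / p.toReal)

/-- The Wiener amalgam norm `‖g‖_{W(p',p)}` on `ℝ³` with window `ψ`,
applied to the pointwise magnitude `g : ℝ³ → ℝ≥0∞` of a function. -/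
def WAx (ψ : EuclideanSpace ℝ (Fin 3) → ℝ) (p' p : ℝ≥0∞)
    (g : EuclideanSpace ℝ (Fin 3) → ℝ≥0∞) : ℝ≥0∞ :=
  LpE MeasureTheory.volume p
    (fun y => LpE MeasureTheory.volume p' (fun x => g x * ‖ψ (x - y)‖₊))

/-- The weak `L^p` quasi-norm `sup_{λ>0} λ |{k : g k > λ}|^{1/p}` on `ℝ`. -/
def wkLp (p : ℝ) (g : ℝ → ℝ≥0∞) : ℝ≥0∞ :=
  ⨆ lam : ℝ≥0, (lam : ℝ≥0∞) *
    (MeasureTheory.volume {k : ℝ | (lam : ℝ≥0∞) < g k}) ^ (1 / p)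

/-- Tail integral of `v f(|v|)`. -/
def Htail (f : ℝ → ℂ) (b z : ℝ) : ℂ := ∫ v in z..b, (v : ℂ) * f |v|

lemma Htail_hasDerivAt (f : ℝ → ℂ) (hf : Continuous f) (b z : ℝ) :
    HasDerivAt (Htail f b) (-((z : ℂ) * f |z|)) z := by
  have hc : Continuous (fun v : ℝ => (v : ℂ) * f |v|) := by fun_prop
  exact intervalIntegral.integral_hasDerivAt_left (hc.intervalIntegrable _ _)
    (hc.stronglyMeasurableAtFilter _ _) hc.continuousAt

lemma Htail_continuous (f : ℝ → ℂ) (hf : Continuous f) (b : ℝ) : Continuous (Htail f b) :=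
  continuous_iff_continuousAt.2 fun z => (Htail_hasDerivAt f hf b z).continuousAt

lemma Htail_zero (f : ℝ → ℂ) (b z : ℝ) (hb : 0 < b) (hfb : ∀ s, b ≤ s → f s = 0)
    (hz : b ≤ z) : Htail f b z = 0 := by
  unfold Htail
  rw [intervalIntegral.integral_congr (g := fun _ => (0 : ℂ))]
  · simp
  · intro v hv
    rw [Set.uIcc_of_ge hz] at hv
    have : b ≤ |v| := hv.1.trans (le_abs_self v)
    simp [hfb _ this]

lemma inner_radial (f : ℝ → ℂ) (hf : Continuous f) (b : ℝ) (hb : 0 < b)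
    (hfb : ∀ s, b ≤ s → f s = 0) (z : ℝ) :
    ∫ u in Set.Ioi (0 : ℝ), (u : ℂ) * f (Real.sqrt (z ^ 2 + u ^ 2)) = Htail f b |z| := by
  have hbig : ∀ u : ℝ, b ≤ u → b ≤ Real.sqrt (z ^ 2 + u ^ 2) := by
    intro u hu
    apply Real.le_sqrt_of_sq_le
    nlinarith [sq_nonneg z]
  have hcs : HasCompactSupport (fun u : ℝ => (u : ℂ) * f (Real.sqrt (z ^ 2 + u ^ 2))) := by
    refine HasCompactSupport.intro (isCompact_Icc (a := -b) (b := b)) ?_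
    intro u hu
    have : b ≤ Real.sqrt (z ^ 2 + u ^ 2) := by
      by_cases h : b ≤ u
      · exact hbig u h
      · have : b ≤ -u := by
          by_contra h'
          exact hu ⟨by linarith, by linarith⟩
        have := hbig (-u) this
        simpa using this
    simp [hfb _ this]
  have hint := (Continuous.integrable_of_hasCompactSupport (μ := volume)
    (by fun_prop : Continuous (fun u : ℝ => (u : ℂ) * f (Real.sqrt (z ^ 2 + u ^ 2)))) hcs)
  have key := integral_Ioi_of_hasDerivAt_of_tendsto (a := (0:ℝ)) (m := 0)
    (f := fun u => - Htail f b (Real.sqrt (z ^ 2 + u ^ 2)))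
    (f' := fun u : ℝ => (u : ℂ) * f (Real.sqrt (z ^ 2 + u ^ 2))) ?_ ?_ hint.integrableOn ?_
  · rw [key]; simp [Real.sqrt_sq_eq_abs]
  · have : Continuous (fun u => - Htail f b (Real.sqrt (z ^ 2 + u ^ 2))) := by
      have := Htail_continuous f hf b
      fun_prop
    exact this.continuousWithinAt
  · intro u hu
    have hu : 0 < u := hu
    have hpos : 0 < z ^ 2 + u ^ 2 := by positivity
    have h1 : HasDerivAt (fun u : ℝ => Real.sqrt (z ^ 2 + u ^ 2))
        (u / Real.sqrt (z ^ 2 + u ^ 2)) u := by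
      have h2 : HasDerivAt (fun u : ℝ => z ^ 2 + u ^ 2) (2 * u) u := by
        have := (hasDerivAt_pow 2 u).const_add (z ^ 2)
        simpa using this
      have := h2.sqrt hpos.ne'
      convert this using 1
      field_simp
    have h3 := ((Htail_hasDerivAt f hf b _).scomp u h1).neg
    refine HasDerivAt.congr_deriv h3 ?_
    rw [abs_of_nonneg (Real.sqrt_nonneg _)]
    have : (Real.sqrt (z ^ 2 + u ^ 2) : ℂ) ≠ 0 := by
      exact_mod_cast (Real.sqrt_pos.2 hpos).ne'
    simp only [Complex.real_smul, Complex.ofReal_div]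
    field_simp
  · apply tendsto_const_nhds.congr'
    filter_upwards [Filter.eventually_ge_atTop b] with u hu
    simp [Htail_zero f b _ hb hfb (hbig u hu)]

lemma plane_radial (f : ℝ → ℂ) (hf : Continuous f) (b : ℝ) (hb : 0 < b)
    (hfb : ∀ s, b ≤ s → f s = 0) (z : ℝ) :
    ∫ p : ℝ × ℝ, f (Real.sqrt (z ^ 2 + (p.1 ^ 2 + p.2 ^ 2))) = 2 * π * Htail f b |z| := by
  rw [← integral_comp_polarCoord_symm, polarCoord_target]
  have : ∀ p : ℝ × ℝ, p.1 • f (Real.sqrt (z ^ 2 + ((polarCoord.symm p).1 ^ 2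
      + (polarCoord.symm p).2 ^ 2)))
      = ((p.1 : ℂ) * f (Real.sqrt (z ^ 2 + p.1 ^ 2))) * (fun _ : ℝ => (1 : ℂ)) p.2 := by
    intro p
    simp only [polarCoord_symm_apply, Complex.real_smul, mul_one]
    congr 4
    nlinarith [Real.sin_sq_add_cos_sq p.2]
  simp_rw [this]
  rw [Measure.volume_eq_prod, setIntegral_prod_mul
    (fun u : ℝ => (u : ℂ) * f (Real.sqrt (z ^ 2 + u ^ 2))) (fun _ : ℝ => (1 : ℂ)),
    inner_radial f hf b hb hfb z]
  simp only [integral_const, MeasurableSet.univ, measureReal_restrict_apply, Set.univ_inter,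
    Real.volume_real_Ioo, Complex.real_smul, mul_one]
  rw [max_eq_left (by linarith [Real.pi_pos])]
  push_cast
  ring

lemma line_radial (f : ℝ → ℂ) (hf : Continuous f) (b : ℝ) (hb : 0 < b)
    (hfb : ∀ s, b ≤ s → f s = 0) (X : ℝ) (hX : 0 < X) :
    ∫ z : ℝ, Complex.exp (I * ((X * z : ℝ) : ℂ)) * Htail f b |z|
      = 2 / X * ∫ s in (0:ℝ)..b, (s : ℂ) * f s * (Real.sin (X * s) : ℂ) := by
  have hH := Htail_continuous f hf b
  have hc : Continuous (fun z : ℝ => Complex.exp (I * ((X * z : ℝ) : ℂ)) * Htail f b |z|) := by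
    fun_prop
  rw [← intervalIntegral.integral_eq_integral_of_support_subset (a := -b) (b := b)]
  · rw [← intervalIntegral.integral_add_adjacent_intervals (b := 0)
      (hc.intervalIntegrable _ _) (hc.intervalIntegrable _ _)]
    have h1 : ∫ z in (-b)..0, Complex.exp (I * ((X * z : ℝ) : ℂ)) * Htail f b |z|
        = ∫ z in (0:ℝ)..b, Complex.exp (-(I * ((X * z : ℝ) : ℂ))) * Htail f b |z| := by
      have := intervalIntegral.integral_comp_neg (a := 0) (b := b)
        (fun z : ℝ => Complex.exp (I * ((X * z : ℝ) : ℂ)) * Htail f b |z|)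
      rw [neg_zero] at this
      rw [← this]
      congr 1
      ext z
      simp
    rw [h1, ← intervalIntegral.integral_add]
    rotate_left
    · exact Continuous.intervalIntegrable (by fun_prop) _ _
    · exact Continuous.intervalIntegrable (by fun_prop) _ _
    have h2 : ∫ z in (0:ℝ)..b, (Complex.exp (-(I * ((X * z : ℝ) : ℂ))) * Htail f b |z|
        + Complex.exp (I * ((X * z : ℝ) : ℂ)) * Htail f b |z|)
        = ∫ z in (0:ℝ)..b, Htail f b z * (2 * (Real.cos (X * z) : ℂ)) := by
      apply intervalIntegral.integral_congr
      intro z hz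
      rw [Set.uIcc_of_le hb.le] at hz
      simp only [abs_of_nonneg hz.1]
      rw [Complex.ofReal_cos, Complex.cos]
      rw [mul_comm I]
      rw [neg_mul]
      ring
    rw [h2, intervalIntegral.integral_mul_deriv_eq_deriv_mul
      (u := Htail f b) (u' := fun z => -((z : ℂ) * f |z|))
      (v := fun z : ℝ => 2 * (Real.sin (X * z) : ℂ) / X)]
    · rw [Htail_zero f b b hb hfb le_rfl, ← intervalIntegral.integral_const_mul]
      simp only [mul_zero, Real.sin_zero, Complex.ofReal_zero, zero_mul, zero_div, zero_sub,
        sub_zero, ← intervalIntegral.integral_neg]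
      apply intervalIntegral.integral_congr
      intro z hz
      rw [Set.uIcc_of_le hb.le] at hz
      simp only [abs_of_nonneg hz.1]
      ring
    · intro z _
      exact Htail_hasDerivAt f hf b z
    · intro z _
      have h3 : HasDerivAt (fun z : ℝ => Real.sin (X * z)) (Real.cos (X * z) * X) z := by
        have := ((hasDerivAt_id z).const_mul X).sin
        simpa using this
      have h4 := (h3.ofReal_comp.const_mul (2 : ℂ)).div_const (X : ℂ)
      convert h4 using 1
      have : (X : ℂ) ≠ 0 := by exact_mod_cast hX.ne'
      push_cast
      field_simp
    · exact Continuous.intervalIntegrable (by fun_prop) _ _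
    · exact Continuous.intervalIntegrable (by fun_prop) _ _
  · intro z hz
    by_contra hn
    apply hz
    have : b ≤ |z| := by
      by_contra h
      rw [not_le, abs_lt] at h
      exact hn ⟨h.1, h.2.le⟩
    simp [Htail_zero f b _ hb hfb this]
lemma dotE_eq_inner (x ξ : EuclideanSpace ℝ (Fin 3)) : dotE x ξ = inner ℝ x ξ := by
  simp [dotE, PiLp.inner_apply, mul_comm]

lemma space_radial_aux (f : ℝ → ℂ) (hf : Continuous f) (b : ℝ) (hb : 0 < b)
    (hfb : ∀ s, b ≤ s → f s = 0) (X : ℝ) (hX : 0 < X) :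
    ∫ ξ : EuclideanSpace ℝ (Fin 3), Complex.exp (I * ((X * ξ 0 : ℝ) : ℂ)) * f ‖ξ‖
      = 4 * π / X * ∫ s in (0:ℝ)..b, (s : ℂ) * f s * (Real.sin (X * s) : ℂ) := by
  set g : ℝ × (ℝ × ℝ) → ℂ := fun p => Complex.exp (I * ((X * p.1 : ℝ) : ℂ)) *
    f (Real.sqrt (p.1 ^ 2 + (p.2.1 ^ 2 + p.2.2 ^ 2))) with hg
  have hgc : Continuous g := by
    rw [hg]; fun_prop
  have hgs : HasCompactSupport g := by
    refine HasCompactSupport.intro (isCompact_Icc (a := ((-b, (-b, -b)) : ℝ × (ℝ × ℝ)))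
      (b := (b, (b, b)))) ?_
    rintro ⟨x, y, z⟩ hp
    have : b ≤ Real.sqrt (x ^ 2 + (y ^ 2 + z ^ 2)) := by
      by_contra hcon
      rw [not_le, Real.sqrt_lt' hb] at hcon
      apply hp
      have hx := abs_le_of_sq_le_sq' (a := x) (b := b) (by nlinarith [sq_nonneg y, sq_nonneg z]) hb.le
      have hy := abs_le_of_sq_le_sq' (a := y) (b := b) (by nlinarith [sq_nonneg x, sq_nonneg z]) hb.le
      have hz := abs_le_of_sq_le_sq' (a := z) (b := b) (by nlinarith [sq_nonneg x, sq_nonneg y]) hb.le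
      exact ⟨⟨hx.1, hy.1, hz.1⟩, ⟨hx.2, hy.2, hz.2⟩⟩
    simp [hg, hfb _ this]
  have hgi : Integrable g := hgc.integrable_of_hasCompactSupport hgs
  have e1 := PiLp.volume_preserving_ofLp (Fin 3)
  have e2 := volume_preserving_piFinSuccAbove (fun _ : Fin 3 => ℝ) 0
  have e3 := (MeasurePreserving.id (volume : Measure ℝ)).prod (volume_preserving_finTwoArrow ℝ)
  have step1 : ∫ ξ : EuclideanSpace ℝ (Fin 3), Complex.exp (I * ((X * ξ 0 : ℝ) : ℂ)) * f ‖ξ‖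
      = ∫ v : Fin 3 → ℝ, Complex.exp (I * ((X * v 0 : ℝ) : ℂ)) *
          f (Real.sqrt (v 0 ^ 2 + (v 1 ^ 2 + v 2 ^ 2))) := by
    rw [← e1.integral_comp (MeasurableEquiv.toLp 2 (Fin 3 → ℝ)).symm.measurableEmbedding]
    congr 1
    ext ξ
    rw [EuclideanSpace.norm_eq]
    simp [Fin.sum_univ_three, add_assoc]
  have step2 : ∫ v : Fin 3 → ℝ, Complex.exp (I * ((X * v 0 : ℝ) : ℂ)) *
          f (Real.sqrt (v 0 ^ 2 + (v 1 ^ 2 + v 2 ^ 2)))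
      = ∫ p : ℝ × (Fin 2 → ℝ), Complex.exp (I * ((X * p.1 : ℝ) : ℂ)) *
          f (Real.sqrt (p.1 ^ 2 + (p.2 0 ^ 2 + p.2 1 ^ 2))) := by
    rw [← e2.integral_comp (MeasurableEquiv.measurableEmbedding _)]
    rfl
  have step3 : ∫ p : ℝ × (Fin 2 → ℝ), Complex.exp (I * ((X * p.1 : ℝ) : ℂ)) *
          f (Real.sqrt (p.1 ^ 2 + (p.2 0 ^ 2 + p.2 1 ^ 2))) = ∫ p, g p := by
    have := e3.integral_comp (((MeasurableEquiv.refl ℝ).prodCongr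
      MeasurableEquiv.finTwoArrow).measurableEmbedding) g
    exact this
  rw [step1, step2, step3, Measure.volume_eq_prod, integral_prod _ hgi]
  have : ∀ z : ℝ, ∫ p : ℝ × ℝ, g (z, p)
      = (2 * π) * (Complex.exp (I * ((X * z : ℝ) : ℂ)) * Htail f b |z|) := by
    intro z
    simp only [hg]
    rw [integral_const_mul, plane_radial f hf b hb hfb z]
    ring
  simp_rw [this]
  rw [integral_const_mul, line_radial f hf b hb hfb X hX]
  ring

lemma space_radial (f : ℝ → ℂ) (hf : Continuous f) (b : ℝ) (hb : 0 < b)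
    (hfb : ∀ s, b ≤ s → f s = 0) (x : EuclideanSpace ℝ (Fin 3)) (hx : x ≠ 0) :
    ∫ ξ : EuclideanSpace ℝ (Fin 3), Complex.exp (I * ((dotE x ξ : ℝ) : ℂ)) * f ‖ξ‖
      = 4 * π / ‖x‖ * ∫ s in (0:ℝ)..b, (s : ℂ) * f s * (Real.sin (‖x‖ * s) : ℂ) := by
  have hX : 0 < ‖x‖ := norm_pos_iff.2 hx
  rw [← space_radial_aux f hf b hb hfb ‖x‖ hX]
  set w : EuclideanSpace ℝ (Fin 3) := EuclideanSpace.single 0 ‖x‖ with hw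
  have hn : ‖w‖ = ‖x‖ := by simp [hw]
  set T := Submodule.reflection (Submodule.span ℝ {w - x})ᗮ with hT
  have hTw : T w = x := Submodule.reflection_sub hn
  have e := T.measurePreserving
  rw [← e.integral_comp T.toHomeomorph.measurableEmbedding]
  congr 1
  ext ξ
  rw [LinearIsometryEquiv.norm_map, dotE_eq_inner]
  congr 4
  conv_lhs => rw [← hTw]
  rw [LinearIsometryEquiv.inner_map_map, hw, EuclideanSpace.inner_single_left]
  simp
/-- One-dimensional bracket. -/
def jb (s : ℝ) : ℝ := Real.sqrt (1 + s ^ 2)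

lemma jb_one_le (s : ℝ) : 1 ≤ jb s := by
  unfold jb
  rw [Real.one_le_sqrt]
  nlinarith [sq_nonneg s]

lemma jb_pos (s : ℝ) : 0 < jb s := lt_of_lt_of_le one_pos (jb_one_le s)

lemma le_jb (s : ℝ) : s ≤ jb s := by
  unfold jb
  apply Real.le_sqrt_of_sq_le
  linarith

lemma jb_quarter {L s : ℝ} (hL : 0 < L) (hs : L / 4 ≤ s) : (1 / 4) * jb L ≤ jb s := by
  unfold jb
  apply Real.le_sqrt_of_sq_le
  rw [mul_pow, Real.sq_sqrt (by positivity)]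
  nlinarith

lemma jb_rpow_le {L s e : ℝ} (hL : 0 < L) (hs : L / 4 ≤ s) (he : e ≤ 0) :
    jb s ^ e ≤ (1 / 4) ^ e * jb L ^ e := by
  rw [← Real.mul_rpow (by norm_num) (jb_pos L).le]
  exact Real.rpow_le_rpow_of_nonpos (by have := jb_pos L; positivity) (jb_quarter hL hs) he

@[fun_prop]
lemma jb_continuous : Continuous jb := by unfold jb; fun_prop

lemma jb_hasDerivAt (s : ℝ) : HasDerivAt jb (s / jb s) s := by
  have h2 : HasDerivAt (fun u : ℝ => 1 + u ^ 2) (2 * s) s := by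
    have := (hasDerivAt_pow 2 s).const_add (1 : ℝ)
    simpa using this
  have := h2.sqrt (by positivity)
  refine HasDerivAt.congr_deriv this ?_
  unfold jb
  field_simp

/-- The cutoff as a function of the radius. -/
def chiR (ρ : ℝ → ℝ) (L s : ℝ) : ℝ := ρ ((2 * L)⁻¹ * s) - ρ (4 / L * s)

lemma chiR_continuous {ρ : ℝ → ℝ} (hρ : Continuous ρ) (L : ℝ) : Continuous (chiR ρ L) := by
  unfold chiR; fun_prop

lemma rho_zero {ρ : ℝ → ℝ} (hρsupp : Function.support ρ ⊆ Set.Ioo (-2) 2) {s : ℝ} (hs : 2 ≤ s) :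
    ρ s = 0 := by
  by_contra h
  have := hρsupp h
  exact absurd this.2 (not_lt.2 hs)

lemma chiR_zero_hi {ρ : ℝ → ℝ} (hρsupp : Function.support ρ ⊆ Set.Ioo (-2) 2) {L s : ℝ}
    (hL : 0 < L) (hs : 4 * L ≤ s) : chiR ρ L s = 0 := by
  unfold chiR
  rw [rho_zero hρsupp, rho_zero hρsupp, sub_zero]
  · rw [div_mul_eq_mul_div, le_div_iff₀ hL]; linarith
  · rw [inv_mul_eq_div, le_div_iff₀ (by positivity)]; linarith

lemma chiR_zero_lo {ρ : ℝ → ℝ} (hρ1 : ∀ s : ℝ, |s| ≤ 1 → ρ s = 1) {L s : ℝ}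
    (hL : 0 < L) (hs0 : 0 ≤ s) (hs : s ≤ L / 4) : chiR ρ L s = 0 := by
  unfold chiR
  rw [hρ1, hρ1, sub_self]
  · rw [abs_of_nonneg (by positivity), div_mul_eq_mul_div, div_le_iff₀ hL]; linarith
  · rw [abs_of_nonneg (by positivity), inv_mul_eq_div, div_le_iff₀ (by positivity)]; linarith

lemma chiR_abs_le {ρ : ℝ → ℝ} {M : ℝ} (hM : ∀ s, |ρ s| ≤ M) (L s : ℝ) :
    |chiR ρ L s| ≤ 2 * M := by
  unfold chiR
  calc _ ≤ |ρ ((2 * L)⁻¹ * s)| + |ρ (4 / L * s)| := abs_sub _ _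
    _ ≤ _ := by linarith [hM ((2 * L)⁻¹ * s), hM (4 / L * s)]

/-- The radial integrand. -/
def Iint (ρ : ℝ → ℝ) (γ L t X s : ℝ) : ℂ :=
  (s : ℂ) * (Complex.exp (I * ((t * jb s : ℝ) : ℂ)) * ((jb s ^ (-γ) * chiR ρ L s : ℝ) : ℂ)) *
    (Real.sin (X * s) : ℂ)

lemma Kloc_formula {ρ : ℝ → ℝ} (hρ : Continuous ρ)
    (hρsupp : Function.support ρ ⊆ Set.Ioo (-2) 2) (hρ1 : ∀ s : ℝ, |s| ≤ 1 → ρ s = 1)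
    (γ : ℝ) (k : ℤ) (x : EuclideanSpace ℝ (Fin 3)) (hx : x ≠ 0) (t : ℝ) :
    Kloc ρ γ k x t = 4 * π / ‖x‖ *
      ∫ s in ((2:ℝ) ^ k / 4)..(4 * (2:ℝ) ^ k), Iint ρ γ ((2:ℝ) ^ k) t ‖x‖ s := by
  set L : ℝ := (2:ℝ) ^ k with hLdef
  have hL : 0 < L := by positivity
  have hχ := chiR_continuous hρ L
  set f : ℝ → ℂ := fun s => Complex.exp (I * ((t * jb s : ℝ) : ℂ)) *
    ((jb s ^ (-γ) * chiR ρ L s : ℝ) : ℂ) with hf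
  have hjc : Continuous (fun s => jb s ^ (-γ)) :=
    jb_continuous.rpow_const fun s => Or.inl (jb_pos s).ne'
  have hfc : Continuous f := by
    rw [hf]
    fun_prop
  have hfb : ∀ s, 4 * L ≤ s → f s = 0 := by
    intro s hs
    simp [hf, chiR_zero_hi hρsupp hL hs]
  have h1 := space_radial f hfc (4 * L) (by positivity) hfb x hx
  have hIc : Continuous (Iint ρ γ L t ‖x‖) := by
    unfold Iint
    fun_prop
  have h2 : ∫ s in (0:ℝ)..(4 * L), (s : ℂ) * f s * (Real.sin (‖x‖ * s) : ℂ)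
      = ∫ s in (L / 4)..(4 * L), Iint ρ γ L t ‖x‖ s := by
    change ∫ s in (0:ℝ)..(4 * L), Iint ρ γ L t ‖x‖ s = _
    rw [← intervalIntegral.integral_add_adjacent_intervals (b := L / 4)
      (hIc.intervalIntegrable _ _) (hIc.intervalIntegrable _ _)]
    rw [intervalIntegral.integral_congr (g := fun _ => (0 : ℂ)) (a := 0) (b := L / 4)]
    · simp
    · intro s hs
      rw [Set.uIcc_of_le (by positivity)] at hs
      simp [Iint, chiR_zero_lo hρ1 hL hs.1 hs.2]
  rw [← h2, ← h1]
  unfold Kloc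
  congr 1
  ext ξ
  have hc : chiLP ρ k ξ = chiR ρ L ‖ξ‖ := by
    unfold chiLP chiR
    congr 3
    · rw [zpow_neg, zpow_add₀ (by norm_num), hLdef]; simp; ring
    · rw [zpow_neg, zpow_sub₀ (by norm_num), hLdef, inv_div]; norm_num
  simp only [hf]
  rw [hc, ← mul_assoc, ← Complex.exp_add]
  congr 2
  push_cast
  rw [mul_add]
  rfl

lemma norm_expI (y : ℝ) : ‖Complex.exp (I * (y : ℂ))‖ = 1 := by
  rw [mul_comm]; exact Complex.norm_exp_ofReal_mul_I y

lemma Iint_norm_le {ρ : ℝ → ℝ} {M : ℝ} (hM : ∀ s, |ρ s| ≤ M) {γ L t X s : ℝ} (hγ : 0 ≤ γ)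
    (hL : 0 < L) (hs : L / 4 ≤ s) (hs' : s ≤ 4 * L) :
    ‖Iint ρ γ L t X s‖ ≤ (4 * L) * ((1/4) ^ (-γ) * jb L ^ (-γ) * (2 * M)) * |Real.sin (X * s)| := by
  have hs0 : 0 ≤ s := by linarith
  unfold Iint
  rw [norm_mul, norm_mul, norm_mul, norm_expI, Complex.norm_real, Complex.norm_real,
    Complex.norm_real, one_mul, Real.norm_eq_abs, Real.norm_eq_abs, Real.norm_eq_abs,
    abs_of_nonneg hs0, abs_mul, abs_of_nonneg (Real.rpow_nonneg (jb_pos s).le _)]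
  have h1 := jb_rpow_le hL hs (e := -γ) (by linarith)
  have h2 := chiR_abs_le hM L s
  have := jb_pos s
  have := jb_pos L
  gcongr

lemma bound_A {ρ : ℝ → ℝ} {M : ℝ} (hM : ∀ s, |ρ s| ≤ M) {γ L t X : ℝ} (hγ : 0 ≤ γ)
    (hL : 0 < L) :
    ‖∫ s in (L / 4)..(4 * L), Iint ρ γ L t X s‖
      ≤ (4 * L) * ((1/4) ^ (-γ) * jb L ^ (-γ) * (2 * M)) * (4 * L) := by
  have hM0 : 0 ≤ M := (abs_nonneg _).trans (hM 0)
  have := jb_pos L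
  refine (intervalIntegral.norm_integral_le_of_norm_le_const
    (C := (4 * L) * ((1/4) ^ (-γ) * jb L ^ (-γ) * (2 * M))) ?_).trans ?_
  · intro s hs
    rw [Set.uIoc_of_le (by linarith)] at hs
    refine (Iint_norm_le hM hγ hL hs.1.le hs.2).trans ?_
    exact mul_le_of_le_one_right (by positivity) (Real.abs_sin_le_one _)
  · rw [abs_of_nonneg (by linarith)]
    gcongr
    linarith

lemma bound_C {ρ : ℝ → ℝ} {M : ℝ} (hM : ∀ s, |ρ s| ≤ M) {γ L t X : ℝ} (hγ : 0 ≤ γ)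
    (hL : 0 < L) (hX : 0 < X) :
    ‖∫ s in (L / 4)..(4 * L), Iint ρ γ L t X s‖
      ≤ X * ((4 * L) * ((1/4) ^ (-γ) * jb L ^ (-γ) * (2 * M)) * (4 * L) * (4 * L)) := by
  have hM0 : 0 ≤ M := (abs_nonneg _).trans (hM 0)
  have := jb_pos L
  refine (intervalIntegral.norm_integral_le_of_norm_le_const
    (C := (4 * L) * ((1/4) ^ (-γ) * jb L ^ (-γ) * (2 * M)) * (X * (4 * L))) ?_).trans ?_
  · intro s hs
    rw [Set.uIoc_of_le (by linarith)] at hs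
    refine (Iint_norm_le hM hγ hL hs.1.le hs.2).trans ?_
    have h1 : |Real.sin (X * s)| ≤ X * (4 * L) := by
      refine Real.abs_sin_le_abs.trans ?_
      have : 0 < s := by linarith [hs.1]
      rw [abs_of_nonneg (by positivity)]
      exact mul_le_mul_of_nonneg_left hs.2 hX.le
    gcongr
  · rw [abs_of_nonneg (by linarith)]
    have h2 : 4 * L - L / 4 ≤ 4 * L := by linarith
    calc _ ≤ (4 * L) * ((1/4) ^ (-γ) * jb L ^ (-γ) * (2 * M)) * (X * (4 * L)) * (4 * L) := by
          gcongr
      _ = _ := by ring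
lemma chiR_hasDerivAt {ρ : ℝ → ℝ} (hρ : Differentiable ℝ ρ) (L s : ℝ) :
    HasDerivAt (chiR ρ L) (deriv ρ ((2 * L)⁻¹ * s) * (2 * L)⁻¹ - deriv ρ (4 / L * s) * (4 / L)) s := by
  have h : ∀ c : ℝ, HasDerivAt (fun s => ρ (c * s)) (deriv ρ (c * s) * c) s := by
    intro c
    have h1 : HasDerivAt (fun s : ℝ => c * s) c s := by
      simpa using (hasDerivAt_id s).const_mul c
    exact (hρ (c * s)).hasDerivAt.comp s h1
  exact (h _).sub (h _)

lemma chiR_deriv_le {ρ : ℝ → ℝ} {M' : ℝ} (hM' : ∀ s, |deriv ρ s| ≤ M') {L : ℝ} (hL : 0 < L)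
    (s : ℝ) :
    |deriv ρ ((2 * L)⁻¹ * s) * (2 * L)⁻¹ - deriv ρ (4 / L * s) * (4 / L)| ≤ 5 * M' / L := by
  have hM0 : 0 ≤ M' := (abs_nonneg _).trans (hM' 0)
  refine (abs_sub _ _).trans ?_
  rw [abs_mul, abs_mul, abs_of_pos (show 0 < (2 * L)⁻¹ by positivity),
    abs_of_pos (show 0 < 4 / L by positivity)]
  calc _ ≤ M' * (2 * L)⁻¹ + M' * (4 / L) := by
        gcongr <;> exact hM' _
    _ ≤ _ := by
        rw [mul_inv]
        have : 0 ≤ M' * L⁻¹ := by positivity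
        have e : 5 * M' / L - (M' * (2⁻¹ * L⁻¹) + M' * (4 / L)) = (1 / 2) * (M' * L⁻¹) := by
          field_simp; norm_num
        linarith

lemma bound_B {ρ : ℝ → ℝ} (hρ : ContDiff ℝ 1 ρ)
    (hρsupp : Function.support ρ ⊆ Set.Ioo (-2) 2) (hρ1 : ∀ s : ℝ, |s| ≤ 1 → ρ s = 1)
    {M M' : ℝ} (hM : ∀ s, |ρ s| ≤ M) (hM' : ∀ s, |deriv ρ s| ≤ M') {γ L t X : ℝ} (hγ : 1 ≤ γ)
    (hL : 0 < L) (hX : 0 < X) (ht : t ≠ 0) :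
    ‖∫ s in (L / 4)..(4 * L), Iint ρ γ L t X s‖
      ≤ X / |t| * (((γ - 1) * (2 * M) + 20 * M' + 2 * M) * ((1/4) ^ (1-γ) * jb L ^ (1-γ)) * (4 * L)) := by
  have hM0 : 0 ≤ M := (abs_nonneg _).trans (hM 0)
  have hM0' : 0 ≤ M' := (abs_nonneg _).trans (hM' 0)
  have hdiff : Differentiable ℝ ρ := hρ.differentiable (by norm_num)
  have hdc : Continuous (deriv ρ) := hρ.continuous_deriv (by norm_num)
  have hρc : Continuous ρ := hρ.continuous
  have hχ := chiR_continuous hρc L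
  have hjL := jb_pos L
  set χ' : ℝ → ℝ := fun s => deriv ρ ((2 * L)⁻¹ * s) * (2 * L)⁻¹ - deriv ρ (4 / L * s) * (4 / L)
    with hχ'
  have hχ'c : Continuous χ' := by rw [hχ']; fun_prop
  set v : ℝ → ℝ := fun s => jb s ^ (1 - γ) * chiR ρ L s * Real.sin (X * s) with hv
  set v' : ℝ → ℝ := fun s => (s / jb s * (1 - γ) * jb s ^ (1 - γ - 1) * chiR ρ L s
    + jb s ^ (1 - γ) * χ' s) * Real.sin (X * s)
    + jb s ^ (1 - γ) * chiR ρ L s * (Real.cos (X * s) * X) with hv'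
  have hjc : ∀ e : ℝ, Continuous (fun s => jb s ^ e) := fun e =>
    jb_continuous.rpow_const fun s => Or.inl (jb_pos s).ne'
  have hjc1 := hjc (1 - γ)
  have hjc2 := hjc (1 - γ - 1)
  have hsj : Continuous (fun s => s / jb s) :=
    continuous_id.div jb_continuous fun s => (jb_pos s).ne'
  have hv'c : Continuous v' := by
    rw [hv']
    fun_prop
  have hvd : ∀ s, HasDerivAt v (v' s) s := by
    intro s
    have h3 : HasDerivAt (fun z : ℝ => Real.sin (X * z)) (Real.cos (X * s) * X) s := by
      have := ((hasDerivAt_id s).const_mul X).sin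
      simpa using this
    have h4 := (jb_hasDerivAt s).rpow_const (p := 1 - γ) (Or.inl (jb_pos s).ne')
    exact (h4.mul (chiR_hasDerivAt hdiff L s)).mul h3
  set e : ℝ → ℂ := fun s => Complex.exp (I * ((t * jb s : ℝ) : ℂ)) with he
  set e' : ℝ → ℂ := fun s => Complex.exp (I * ((t * jb s : ℝ) : ℂ)) * (I * ((t * (s / jb s) : ℝ) : ℂ))
    with he'
  have hed : ∀ s, HasDerivAt e (e' s) s := by
    intro s
    have h1 := (((jb_hasDerivAt s).const_mul t).ofReal_comp.const_mul I).cexp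
    exact h1
  have hec : Continuous e := by rw [he]; fun_prop
  have he'c : Continuous e' := by rw [he']; fun_prop
  have hparts := intervalIntegral.integral_mul_deriv_eq_deriv_mul (a := L / 4) (b := 4 * L)
    (u := fun s => (v s : ℂ)) (u' := fun s => (v' s : ℂ)) (v := e) (v' := e')
    (fun s _ => (hvd s).ofReal_comp) (fun s _ => hed s)
    (Continuous.intervalIntegrable (by fun_prop) _ _) (he'c.intervalIntegrable _ _)
  have hva : v (L / 4) = 0 := by
    simp [hv, chiR_zero_lo hρ1 hL (by positivity : 0 ≤ L / 4) le_rfl]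
  have hvb : v (4 * L) = 0 := by
    simp [hv, chiR_zero_hi hρsupp hL le_rfl]
  rw [hva, hvb] at hparts
  simp only [Complex.ofReal_zero, zero_mul, sub_zero, zero_sub] at hparts
  have heq : ∫ s in (L / 4)..(4 * L), (v s : ℂ) * e' s
      = (I * t) * ∫ s in (L / 4)..(4 * L), Iint ρ γ L t X s := by
    rw [← intervalIntegral.integral_const_mul]
    congr 1
    ext s
    simp only [hv, he', Iint]
    have : jb s ^ (1 - γ) = jb s ^ (-γ) * jb s := by
      rw [← Real.rpow_add_one (jb_pos s).ne']
      congr 1; ring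
    rw [this]
    have hj : (jb s : ℂ) ≠ 0 := by exact_mod_cast (jb_pos s).ne'
    push_cast
    field_simp
  have hnorm : |t| * ‖∫ s in (L / 4)..(4 * L), Iint ρ γ L t X s‖
      = ‖∫ s in (L / 4)..(4 * L), (v' s : ℂ) * e s‖ := by
    have := congrArg norm (heq.symm.trans hparts)
    rw [norm_mul, norm_mul, norm_neg, Complex.norm_I, one_mul, Complex.norm_real] at this
    exact this
  have hb : ‖∫ s in (L / 4)..(4 * L), (v' s : ℂ) * e s‖ ≤
      (X * (((γ - 1) * (2 * M) + 20 * M' + 2 * M) * ((1/4) ^ (1-γ) * jb L ^ (1-γ)))) * (4 * L) := by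
    refine (intervalIntegral.norm_integral_le_of_norm_le_const
      (C := X * (((γ - 1) * (2 * M) + 20 * M' + 2 * M) * ((1/4) ^ (1-γ) * jb L ^ (1-γ)))) ?_).trans ?_
    · intro s hs
      rw [Set.uIoc_of_le (by linarith)] at hs
      have hs0 : 0 < s := by linarith [hs.1]
      have hjs := jb_pos s
      have hsin : |Real.sin (X * s)| ≤ X * s := by
        refine Real.abs_sin_le_abs.trans ?_
        rw [abs_of_nonneg (by positivity)]
      have hcos : |Real.cos (X * s)| ≤ 1 := Real.abs_cos_le_one _
      have hχb := chiR_abs_le hM L s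
      have hχb' : |χ' s| ≤ 5 * M' / L := chiR_deriv_le hM' hL s
      have hJ := jb_rpow_le hL hs.1.le (e := 1 - γ) (by linarith)
      have hJ0 : 0 ≤ jb s ^ (1 - γ) := Real.rpow_nonneg hjs.le _
      rw [norm_mul, norm_expI, mul_one, Complex.norm_real, Real.norm_eq_abs]
      have hsub : jb s ^ (1 - γ - 1) = jb s ^ (1 - γ) / jb s := by
        rw [Real.rpow_sub_one hjs.ne']
      have t1 : |s / jb s * (1 - γ) * jb s ^ (1 - γ - 1) * chiR ρ L s * Real.sin (X * s)|
          ≤ X * ((γ - 1) * (2 * M)) * jb s ^ (1 - γ) := by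
        rw [abs_mul, abs_mul, abs_mul, abs_mul, hsub, abs_of_nonneg (by positivity : 0 ≤ s / jb s),
          abs_of_nonneg (by positivity : 0 ≤ jb s ^ (1 - γ) / jb s), abs_sub_comm 1 γ,
          abs_of_nonneg (by linarith : 0 ≤ γ - 1)]
        have hγ1 : 0 ≤ γ - 1 := by linarith
        calc _ ≤ s / jb s * (γ - 1) * (jb s ^ (1 - γ) / jb s) * (2 * M) * (X * s) := by gcongr
          _ = (s / jb s) * (s / jb s) * (X * ((γ - 1) * (2 * M)) * jb s ^ (1 - γ)) := by
              field_simp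
          _ ≤ 1 * 1 * (X * ((γ - 1) * (2 * M)) * jb s ^ (1 - γ)) := by
              have : s / jb s ≤ 1 := (div_le_one hjs).2 (le_jb s)
              gcongr
          _ = _ := by ring
      have t2 : |jb s ^ (1 - γ) * χ' s * Real.sin (X * s)| ≤ X * (20 * M') * jb s ^ (1 - γ) := by
        rw [abs_mul, abs_mul, abs_of_nonneg hJ0]
        calc _ ≤ jb s ^ (1 - γ) * (5 * M' / L) * (X * (4 * L)) := by
              have : X * s ≤ X * (4 * L) := mul_le_mul_of_nonneg_left hs.2 hX.le
              have := hsin.trans this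
              gcongr
          _ = _ := by field_simp; ring
      have t3 : |jb s ^ (1 - γ) * chiR ρ L s * (Real.cos (X * s) * X)|
          ≤ X * (2 * M) * jb s ^ (1 - γ) := by
        rw [abs_mul, abs_mul, abs_mul, abs_of_nonneg hJ0, abs_of_pos hX]
        calc _ ≤ jb s ^ (1 - γ) * (2 * M) * (1 * X) := by gcongr
          _ = _ := by ring
      have hsplit : v' s = s / jb s * (1 - γ) * jb s ^ (1 - γ - 1) * chiR ρ L s * Real.sin (X * s)
          + jb s ^ (1 - γ) * χ' s * Real.sin (X * s)
          + jb s ^ (1 - γ) * chiR ρ L s * (Real.cos (X * s) * X) := by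
        simp only [hv']; ring
      rw [hsplit]
      refine (abs_add_three _ _ _).trans ?_
      have hD : 0 ≤ X * ((γ - 1) * (2 * M) + 20 * M' + 2 * M) := by
        have : 0 ≤ γ - 1 := by linarith
        positivity
      have := mul_le_mul_of_nonneg_left hJ hD
      linarith
    · rw [abs_of_nonneg (by linarith)]
      have : 0 ≤ γ - 1 := by linarith
      gcongr
      linarith
  have htp : 0 < |t| := abs_pos.2 ht
  rw [div_mul_eq_mul_div, le_div_iff₀ htp, mul_comm, hnorm]
  refine hb.trans (le_of_eq (by ring))

lemma rho_bounds {ρ : ℝ → ℝ} (hρ : ContDiff ℝ 1 ρ)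
    (hρsupp : Function.support ρ ⊆ Set.Ioo (-2) 2) :
    ∃ M M' : ℝ, (∀ s, |ρ s| ≤ M) ∧ (∀ s, |deriv ρ s| ≤ M') := by
  have hcs : HasCompactSupport ρ := by
    refine HasCompactSupport.intro (isCompact_Icc (a := (-2:ℝ)) (b := 2)) ?_
    intro s hs
    by_contra h
    exact hs (Set.Ioo_subset_Icc_self (hρsupp h))
  obtain ⟨M, hM⟩ := hρ.continuous.bounded_above_of_compact_support hcs
  obtain ⟨M', hM'⟩ := (hρ.continuous_deriv (by norm_num)).bounded_above_of_compact_support hcs.deriv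
  exact ⟨M, M', hM, hM'⟩

lemma Kloc_bounds {ρ : ℝ → ℝ} (hρ : ContDiff ℝ 1 ρ)
    (hρsupp : Function.support ρ ⊆ Set.Ioo (-2) 2) (hρ1 : ∀ s : ℝ, |s| ≤ 1 → ρ s = 1)
    {γ : ℝ} (hγ : 1 ≤ γ) :
    ∃ C : ℝ, 0 ≤ C ∧ ∀ (k : ℤ) (x : EuclideanSpace ℝ (Fin 3)) (t : ℝ), x ≠ 0 → t ≠ 0 →
      ‖Kloc ρ γ k x t‖ ≤ C * ((2:ℝ) ^ k * jb ((2:ℝ) ^ k) ^ (2 - γ)) ∧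
      ‖Kloc ρ γ k x t‖ ≤ C * ((2:ℝ) ^ k * jb ((2:ℝ) ^ k) ^ (2 - γ)) *
        (jb ((2:ℝ) ^ k) * max ‖x‖ |t|)⁻¹ := by
  obtain ⟨M, M', hM, hM'⟩ := rho_bounds hρ hρsupp
  have hM0 : 0 ≤ M := (abs_nonneg _).trans (hM 0)
  have hM0' : 0 ≤ M' := (abs_nonneg _).trans (hM' 0)
  have hγ1 : 0 ≤ γ - 1 := by linarith
  set C1 : ℝ := 4 * π * (64 * ((1/4) ^ (-γ) * (2 * M))) with hC1
  set C2 : ℝ := 4 * π * (((γ - 1) * (2 * M) + 20 * M' + 2 * M) * (1/4) ^ (1-γ) * 4) with hC2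
  have hC10 : 0 ≤ C1 := by positivity
  have hC20 : 0 ≤ C2 := by positivity
  refine ⟨C1 + C2, by positivity, ?_⟩
  intro k x t hx ht
  set L : ℝ := (2:ℝ) ^ k with hLdef
  have hL : 0 < L := by positivity
  have hX : 0 < ‖x‖ := norm_pos_iff.2 hx
  have htp : 0 < |t| := abs_pos.2 ht
  have hjL := jb_pos L
  have hLj := le_jb L
  have hn : ‖Kloc ρ γ k x t‖ = 4 * π / ‖x‖ * ‖∫ s in (L / 4)..(4 * L), Iint ρ γ L t ‖x‖ s‖ := by
    rw [Kloc_formula hρ.continuous hρsupp hρ1 γ k x hx t, norm_mul]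
    congr 1
    have : (4 * π / ‖x‖ : ℂ) = ((4 * π / ‖x‖ : ℝ) : ℂ) := by push_cast; rfl
    rw [this, Complex.norm_real, Real.norm_eq_abs, abs_of_pos (by positivity)]
  have hA := bound_A hM (γ := γ) (L := L) (t := t) (X := ‖x‖) (by linarith) hL
  have hB := bound_B hρ hρsupp hρ1 hM hM' (γ := γ) (L := L) (t := t) (X := ‖x‖) hγ hL hX ht
  have hC := bound_C hM (γ := γ) (L := L) (t := t) (X := ‖x‖) (by linarith) hL hX
  have r1 : jb L ^ (2 - γ) = jb L ^ (-γ) * jb L * jb L := by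
    rw [← Real.rpow_add_one hjL.ne', ← Real.rpow_add_one hjL.ne']
    congr 1; ring
  have r2 : jb L ^ (2 - γ) = jb L ^ (1 - γ) * jb L := by
    rw [← Real.rpow_add_one hjL.ne']
    congr 1; ring
  have hp0 : 0 ≤ jb L ^ (-γ) := Real.rpow_nonneg hjL.le _
  have hp1 : 0 ≤ jb L ^ (1-γ) := Real.rpow_nonneg hjL.le _
  have hp2 : 0 ≤ jb L ^ (2-γ) := Real.rpow_nonneg hjL.le _
  rw [hn]
  constructor
  · calc _ ≤ 4 * π / ‖x‖ *
          (‖x‖ * ((4 * L) * ((1/4) ^ (-γ) * jb L ^ (-γ) * (2 * M)) * (4 * L) * (4 * L))) := by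
          gcongr
      _ = C1 * (L * (jb L ^ (-γ) * L * L)) := by
          rw [hC1]; field_simp; ring
      _ ≤ C1 * (L * (jb L ^ (-γ) * jb L * jb L)) := by gcongr
      _ = C1 * (L * jb L ^ (2 - γ)) := by rw [r1]
      _ ≤ (C1 + C2) * (L * jb L ^ (2 - γ)) := by gcongr; linarith
  · rcases le_total |t| ‖x‖ with h | h
    · rw [max_eq_left h]
      calc _ ≤ 4 * π / ‖x‖ * ((4 * L) * ((1/4) ^ (-γ) * jb L ^ (-γ) * (2 * M)) * (4 * L)) := by
            gcongr
        _ = (C1 / 4) * (L * (jb L ^ (-γ) * L)) * ‖x‖⁻¹ := by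
            rw [hC1]; field_simp; ring
        _ ≤ C1 * (L * (jb L ^ (-γ) * jb L)) * ‖x‖⁻¹ := by gcongr; linarith
        _ = C1 * (L * jb L ^ (2 - γ)) * (jb L * ‖x‖)⁻¹ := by rw [r1]; field_simp
        _ ≤ _ := by gcongr; linarith
    · rw [max_eq_right h]
      calc _ ≤ 4 * π / ‖x‖ * (‖x‖ / |t| * (((γ - 1) * (2 * M) + 20 * M' + 2 * M) *
              ((1/4) ^ (1-γ) * jb L ^ (1-γ)) * (4 * L))) := by
            gcongr
        _ = C2 * (L * jb L ^ (1 - γ)) * |t|⁻¹ := by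
            rw [hC2]; field_simp
        _ = C2 * (L * jb L ^ (2 - γ)) * (jb L * |t|)⁻¹ := by rw [r2]; field_simp
        _ ≤ _ := by gcongr; linarith
lemma interp_le {N B y a : ℝ} (hB : 0 ≤ B) (hy : 0 < y) (ha0 : 0 ≤ a) (ha1 : a ≤ 1)
    (h1 : N ≤ B) (h2 : N ≤ B * y⁻¹) : N ≤ B * y ^ (-a) := by
  rcases le_total y 1 with h | h
  · refine h1.trans (le_mul_of_one_le_right hB ?_)
    exact Real.one_le_rpow_of_pos_of_le_one_of_nonpos hy h (by linarith)
  · refine h2.trans (mul_le_mul_of_nonneg_left ?_ hB)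
    rw [← Real.rpow_neg_one]
    exact Real.rpow_le_rpow_of_exponent_le h (by linarith)

lemma summable_weight {e : ℝ} (he0 : e < 0) (he : 1 + e < 0) :
    Summable (fun k : ℤ => (2:ℝ) ^ k * jb ((2:ℝ) ^ k) ^ e) := by
  apply Summable.of_nat_of_neg
  · have hg : Summable (fun n : ℕ => ((2:ℝ) ^ (1 + e)) ^ n) := by
      apply summable_geometric_of_lt_one (by positivity)
      exact Real.rpow_lt_one_of_one_lt_of_neg (by norm_num) he
    refine Summable.of_nonneg_of_le (fun n => ?_) (fun n => ?_) hg
    · have := jb_pos ((2:ℝ) ^ (n : ℤ)); positivity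
    · have h1 : jb ((2:ℝ) ^ (n : ℤ)) ^ e ≤ ((2:ℝ) ^ (n:ℤ)) ^ e :=
        Real.rpow_le_rpow_of_nonpos (by positivity) (le_jb _) he0.le
      calc _ ≤ (2:ℝ) ^ (n:ℤ) * ((2:ℝ) ^ (n:ℤ)) ^ e := by gcongr
        _ = ((2:ℝ) ^ (n:ℤ)) ^ (1 + e) := by
            rw [Real.rpow_add (by positivity), Real.rpow_one]
        _ = _ := by
            rw [zpow_natCast, ← Real.rpow_natCast, ← Real.rpow_natCast, ← Real.rpow_mul (by norm_num),
              ← Real.rpow_mul (by norm_num), mul_comm]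
  · refine Summable.of_nonneg_of_le (fun n => ?_) (fun n => ?_) summable_geometric_two
    · have := jb_pos ((2:ℝ) ^ (-(n : ℤ))); positivity
    · have h1 : jb ((2:ℝ) ^ (-(n : ℤ))) ^ e ≤ 1 :=
        Real.rpow_le_one_of_one_le_of_nonpos (jb_one_le _) he0.le
      calc _ ≤ (2:ℝ) ^ (-(n:ℤ)) * 1 := by gcongr
        _ = _ := by rw [mul_one, zpow_neg, zpow_natCast, one_div, inv_pow]

lemma Kker_bound {ρ : ℝ → ℝ} (hρ : ContDiff ℝ 1 ρ)
    (hρsupp : Function.support ρ ⊆ Set.Ioo (-2) 2) (hρ1 : ∀ s : ℝ, |s| ≤ 1 → ρ s = 1)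
    {γ a : ℝ} (hγ : 2 < γ) (ha0 : 0 ≤ a) (ha1 : a ≤ 1) (haγ : 3 - γ < a) :
    ∃ C : ℝ, 0 ≤ C ∧ ∀ (x : EuclideanSpace ℝ (Fin 3)) (t : ℝ), x ≠ 0 → t ≠ 0 →
      ‖Kker ρ γ x t‖ ≤ C * (max ‖x‖ |t|) ^ (-a) := by
  obtain ⟨C, hC0, hC⟩ := Kloc_bounds hρ hρsupp hρ1 (γ := γ) (by linarith)
  have hs := summable_weight (e := 2 - γ - a) (by linarith) (by linarith)
  refine ⟨C * ∑' k : ℤ, (2:ℝ) ^ k * jb ((2:ℝ) ^ k) ^ (2 - γ - a), ?_, ?_⟩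
  · refine mul_nonneg hC0 (tsum_nonneg fun k => ?_)
    have := jb_pos ((2:ℝ) ^ k); positivity
  intro x t hx ht
  have hR : 0 < max ‖x‖ |t| := lt_max_of_lt_left (norm_pos_iff.2 hx)
  have hk : ∀ k : ℤ, ‖Kloc ρ γ k x t‖ ≤
      C * (max ‖x‖ |t|) ^ (-a) * ((2:ℝ) ^ k * jb ((2:ℝ) ^ k) ^ (2 - γ - a)) := by
    intro k
    have hj := jb_pos ((2:ℝ) ^ k)
    obtain ⟨h1, h2⟩ := hC k x t hx ht
    have := interp_le (by positivity) (by positivity) ha0 ha1 h1 h2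
    refine this.trans (le_of_eq ?_)
    rw [Real.mul_rpow hj.le hR.le, sub_eq_add_neg (2 - γ) a, Real.rpow_add hj]
    ring
  unfold Kker
  refine (tsum_of_norm_bounded (hs.hasSum.mul_left (C * (max ‖x‖ |t|) ^ (-a))) hk).trans ?_
  exact le_of_eq (by ring)
section LpElemmas
variable {α : Type*} [MeasurableSpace α] {μ : Measure α}

lemma LpE_mono_ae (p : ℝ≥0∞) {f g : α → ℝ≥0∞} (h : ∀ᵐ x ∂μ, f x ≤ g x) :
    LpE μ p f ≤ LpE μ p g := by
  unfold LpE
  split_ifs with hp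
  · exact essSup_mono_ae h
  · apply ENNReal.rpow_le_rpow _ (by positivity)
    apply lintegral_mono_ae
    filter_upwards [h] with x hx
    exact ENNReal.rpow_le_rpow hx (by positivity)

lemma LpE_const_mul {p : ℝ≥0∞} (hp0 : p ≠ 0) {c : ℝ≥0∞} (hc : c ≠ ∞) (f : α → ℝ≥0∞) :
    LpE μ p (fun x => c * f x) = c * LpE μ p f := by
  unfold LpE
  split_ifs with hp
  · exact ENNReal.essSup_const_mul
  · have hpos : 0 < p.toReal := ENNReal.toReal_pos hp0 hp
    simp_rw [ENNReal.mul_rpow_of_nonneg _ _ hpos.le]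
    rw [lintegral_const_mul' _ _ (ENNReal.rpow_ne_top_of_nonneg hpos.le hc),
      ENNReal.mul_rpow_of_nonneg _ _ (by positivity), ← ENNReal.rpow_mul,
      mul_one_div_cancel hpos.ne', ENNReal.rpow_one]

lemma LpE_indicator_le {p : ℝ≥0∞} (hp0 : p ≠ 0) {S : Set α} (hS : MeasurableSet S) :
    LpE μ p (S.indicator fun _ => 1) ≤ 1 + μ S ^ (1 / p.toReal) := by
  unfold LpE
  split_ifs with hp
  · refine (essSup_le_of_ae_le 1 (ae_of_all _ fun x => ?_)).trans le_self_add
    exact Set.indicator_le_self' (f := fun _ => (1 : ℝ≥0∞)) (by simp) x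
  · have hpos : 0 < p.toReal := ENNReal.toReal_pos hp0 hp
    have : (fun a => (S.indicator (fun _ => (1 : ℝ≥0∞)) a) ^ p.toReal)
        = S.indicator fun _ => (1 : ℝ≥0∞) := by
      ext a
      by_cases ha : a ∈ S <;> simp [ha, hpos]
    rw [this, lintegral_indicator hS]
    simp

end LpElemmas

lemma LpE_local {E : Type*} [NormedAddCommGroup E] [NormedSpace ℝ E] [FiniteDimensional ℝ E]
    [MeasurableSpace E] [BorelSpace E] (μ : Measure E) [μ.IsAddHaarMeasure]
    (hd : 1 ≤ Module.finrank ℝ E) {p : ℝ≥0∞} (hp0 : p ≠ 0) (hp : p ≠ ∞) {b : ℝ} (R : ℝ)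
    (hb : b * p.toReal < Module.finrank ℝ E) :
    LpE μ p ((Metric.ball (0 : E) R).indicator fun x => ENNReal.ofReal (‖x‖ ^ (-b))) < ∞ := by
  have hpos : 0 < p.toReal := ENNReal.toReal_pos hp0 hp
  unfold LpE
  rw [if_neg hp]
  apply ENNReal.rpow_lt_top_of_nonneg (by positivity)
  have : (fun a => ((Metric.ball (0 : E) R).indicator (fun x => ENNReal.ofReal (‖x‖ ^ (-b))) a)
      ^ p.toReal) = (Metric.ball (0 : E) R).indicator
        fun x => ENNReal.ofReal (‖x‖ ^ (-(b * p.toReal))) := by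
    ext a
    by_cases ha : a ∈ Metric.ball (0 : E) R
    · rw [Set.indicator_of_mem ha, Set.indicator_of_mem ha,
        ENNReal.ofReal_rpow_of_nonneg (by positivity) hpos.le, ← Real.rpow_mul (norm_nonneg _),
        neg_mul]
    · rw [Set.indicator_of_notMem ha, Set.indicator_of_notMem ha, ENNReal.zero_rpow_of_pos hpos]
  rw [this, lintegral_indicator measurableSet_ball]
  apply ne_of_lt
  apply IntegrableOn.setLIntegral_lt_top
  apply integrableOn_ball_of_norm_le_rpow (C := 1) hd hb
  · refine ae_of_all _ fun x => ?_
    rw [Real.norm_of_nonneg (by positivity), one_mul]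
  · have : Measurable fun x : E => ‖x‖ ^ (-(b * p.toReal)) := by fun_prop
    exact this.aestronglyMeasurable

lemma LpE_japanese {p : ℝ} (hp : 3 < p) :
    LpE (volume : Measure (EuclideanSpace ℝ (Fin 3))) (ENNReal.ofReal p)
      (fun y => ENNReal.ofReal ((1 + ‖y‖)⁻¹)) < ∞ := by
  unfold LpE
  rw [if_neg ENNReal.ofReal_ne_top, ENNReal.toReal_ofReal (by linarith)]
  apply ENNReal.rpow_lt_top_of_nonneg (by positivity)
  have := finite_integral_one_add_norm (E := EuclideanSpace ℝ (Fin 3)) (μ := volume) (r := p)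
    (by simpa using hp)
  convert this.ne using 2
  ext y
  rw [ENNReal.ofReal_rpow_of_nonneg (by positivity) (by linarith), Real.inv_rpow (by positivity),
    Real.rpow_neg (by positivity)]

lemma LpE_scale {p : ℝ} (hp : 0 < p) (f : EuclideanSpace ℝ (Fin 3) → ℝ≥0∞) (hf : Measurable f)
    {c : ℝ} (hc : 0 < c) :
    LpE (volume : Measure (EuclideanSpace ℝ (Fin 3))) (ENNReal.ofReal p) (fun y => f (c⁻¹ • y))
      = ENNReal.ofReal (c ^ (3 / p)) * LpE volume (ENNReal.ofReal p) f := by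
  unfold LpE
  rw [if_neg ENNReal.ofReal_ne_top, if_neg ENNReal.ofReal_ne_top, ENNReal.toReal_ofReal hp.le]
  have h1 : ∫⁻ y : EuclideanSpace ℝ (Fin 3), f (c⁻¹ • y) ^ p
      = ENNReal.ofReal (c ^ (3:ℝ)) * ∫⁻ y, f y ^ p := by
    rw [← lintegral_map (f := fun y => f y ^ p) (by fun_prop) (by fun_prop : Measurable fun
      y : EuclideanSpace ℝ (Fin 3) => c⁻¹ • y),
      Measure.map_addHaar_smul volume (inv_ne_zero hc.ne'), lintegral_smul_measure]
    congr 1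
    simp [abs_of_pos hc]
  rw [h1, ENNReal.mul_rpow_of_nonneg _ _ (by positivity),
    ENNReal.ofReal_rpow_of_nonneg (by positivity) (by positivity), ← Real.rpow_mul hc.le,
    mul_one_div]
abbrev E3 := EuclideanSpace ℝ (Fin 3)

lemma psi_bound {ψ : E3 → ℝ} (hψ : Continuous ψ) (hψsupp : Function.support ψ ⊆ Metric.ball 0 1) :
    ∃ M : ℝ≥0, ∀ x, (‖ψ x‖₊ : ℝ≥0∞) ≤ M := by
  have hcs : HasCompactSupport ψ := by
    refine HasCompactSupport.intro (isCompact_closedBall (0 : E3) 1) ?_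
    intro s hs
    by_contra h
    exact hs (Metric.ball_subset_closedBall (hψsupp h))
  obtain ⟨M, hM⟩ := hψ.bounded_above_of_compact_support hcs
  refine ⟨M.toNNReal, fun x => ?_⟩
  rw [ENNReal.coe_le_coe, ← NNReal.coe_le_coe]
  exact (hM x).trans (Real.le_coe_toNNReal M)

lemma psi_zero {ψ : E3 → ℝ} (hψsupp : Function.support ψ ⊆ Metric.ball 0 1) {x y : E3}
    (h : x ∉ Metric.ball y 1) : ψ (x - y) = 0 := by
  by_contra h'
  apply h
  have := hψsupp h'
  simpa [dist_eq_norm] using this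

lemma ae_ne_zero_E3 : ∀ᵐ x : E3, x ≠ 0 := by
  rw [ae_iff]
  simp

/-- Inner local norm with a sup bound. -/
lemma inner_sup {ψ : E3 → ℝ} (hψsupp : Function.support ψ ⊆ Metric.ball 0 1) {M : ℝ≥0}
    (hM : ∀ x, (‖ψ x‖₊ : ℝ≥0∞) ≤ M) {P : ℝ} (hP : 0 < P) (g : E3 → ℝ≥0∞) (y : E3) {A : ℝ≥0∞}
    (hA : A ≠ ∞) (hg : ∀ x, x ≠ 0 → x ∈ Metric.ball y 1 → g x ≤ A) :
    LpE volume (ENNReal.ofReal P) (fun x => g x * ‖ψ (x - y)‖₊)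
      ≤ A * (M * (1 + volume (Metric.ball (0 : E3) 1) ^ (1 / P))) := by
  have hp0 : ENNReal.ofReal P ≠ 0 := by simpa using hP
  calc _ ≤ LpE volume (ENNReal.ofReal P)
        (fun x => (A * M) * (Metric.ball y 1).indicator (fun _ => 1) x) := by
        apply LpE_mono_ae
        filter_upwards [ae_ne_zero_E3] with x hx
        by_cases h : x ∈ Metric.ball y 1
        · rw [Set.indicator_of_mem h, mul_one]
          gcongr
          · exact hg x hx h
          · exact ENNReal.coe_le_coe.1 (hM _)
        · rw [psi_zero hψsupp h]; simp
    _ = (A * M) * LpE volume (ENNReal.ofReal P) ((Metric.ball y 1).indicator (fun _ => 1)) := by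
        rw [LpE_const_mul hp0 (ENNReal.mul_ne_top hA ENNReal.coe_ne_top)]
    _ ≤ (A * M) * (1 + volume (Metric.ball y 1) ^ (1 / (ENNReal.ofReal P).toReal)) := by
        gcongr
        exact LpE_indicator_le hp0 measurableSet_ball
    _ = _ := by
        rw [ENNReal.toReal_ofReal hP.le, Measure.addHaar_ball_center volume y 1, mul_assoc]

lemma h_large {ψ : E3 → ℝ} (hψ : Continuous ψ)
    (hψsupp : Function.support ψ ⊆ Metric.ball 0 1) {P p : ℝ} (hp : 3 < p) (hP : 0 < P)
    {C : ℝ} (hC : 0 ≤ C) :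
    ∃ B : ℝ≥0∞, B ≠ ∞ ∧ ∀ (t : ℝ) (g : E3 → ℝ≥0∞), 1 ≤ |t| →
      (∀ x, x ≠ 0 → g x ≤ ENNReal.ofReal (C * (max ‖x‖ |t|)⁻¹)) →
      WAx ψ (ENNReal.ofReal P) (ENNReal.ofReal p) g ≤ B * ENNReal.ofReal (|t| ^ (-1 + 3 / p)) := by
  obtain ⟨M, hM⟩ := psi_bound hψ hψsupp
  set c1 : ℝ≥0∞ := M * (1 + volume (Metric.ball (0 : E3) 1) ^ (1 / P)) with hc1
  have hc1t : c1 ≠ ∞ := by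
    refine ENNReal.mul_ne_top ENNReal.coe_ne_top (ENNReal.add_ne_top.2 ⟨ENNReal.one_ne_top, ?_⟩)
    exact ENNReal.rpow_ne_top_of_nonneg (by positivity) measure_ball_lt_top.ne
  set J := LpE (volume : Measure E3) (ENNReal.ofReal p)
      (fun y => ENNReal.ofReal ((1 + ‖y‖)⁻¹)) with hJ
  have hJt : J ≠ ∞ := (LpE_japanese hp).ne
  have hp0 : ENNReal.ofReal p ≠ 0 := by simp; linarith
  refine ⟨c1 * ENNReal.ofReal (C * 3) * J, by finiteness, ?_⟩
  intro t g ht hg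
  have htp : 0 < |t| := by linarith
  unfold WAx
  calc _ ≤ LpE volume (ENNReal.ofReal p) (fun y : E3 =>
        (c1 * ENNReal.ofReal (C * 3) * ENNReal.ofReal (|t|⁻¹)) *
          (fun z : E3 => ENNReal.ofReal ((1 + ‖z‖)⁻¹)) (|t|⁻¹ • y)) := by
        apply LpE_mono_ae
        refine ae_of_all _ fun y => ?_
        refine (inner_sup hψsupp hM hP g y (A := ENNReal.ofReal (C * (3 * (|t| + ‖y‖)⁻¹)))
          ENNReal.ofReal_ne_top ?_).trans (le_of_eq ?_)
        · intro x hx hxy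
          refine (hg x hx).trans (ENNReal.ofReal_le_ofReal ?_)
          gcongr
          rw [← div_eq_mul_inv, ← inv_div]
          apply inv_anti₀ (by positivity)
          rw [div_le_iff₀ (by norm_num)]
          have h1 : ‖y‖ ≤ ‖x‖ + 1 := by
            rw [Metric.mem_ball, dist_eq_norm] at hxy
            have := norm_sub_norm_le y x
            rw [norm_sub_rev] at this
            linarith
          have h2 := le_max_left ‖x‖ |t|
          have h3 := le_max_right ‖x‖ |t|
          linarith
        · beta_reduce
          rw [← hc1, norm_smul, norm_inv, Real.norm_eq_abs, abs_abs, mul_comm _ c1, mul_assoc c1,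
            mul_assoc c1, ← ENNReal.ofReal_mul (by positivity), ← ENNReal.ofReal_mul (by positivity)]
          congr 2
          field_simp
    _ = (c1 * ENNReal.ofReal (C * 3) * ENNReal.ofReal (|t|⁻¹)) *
          (ENNReal.ofReal (|t| ^ (3 / p)) * J) := by
        rw [LpE_const_mul hp0 (by finiteness), LpE_scale (by linarith) (fun z : E3 => ENNReal.ofReal ((1 + ‖z‖)⁻¹)) (by fun_prop) htp]
    _ = _ := by
        rw [Real.rpow_add htp, Real.rpow_neg_one, ENNReal.ofReal_mul (p := |t|⁻¹) (by positivity)]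
        ring

lemma h_small {ψ : E3 → ℝ} (hψ : Continuous ψ)
    (hψsupp : Function.support ψ ⊆ Metric.ball 0 1) {P p : ℝ} (hp : 3 < p) (hP : 0 < P)
    {C b c : ℝ} (hC : 0 ≤ C) (hb : 0 ≤ b) (hc : 0 ≤ c) (hbP : b * P < 3) :
    ∃ B : ℝ≥0∞, B ≠ ∞ ∧ ∀ (t : ℝ) (g : E3 → ℝ≥0∞), t ≠ 0 → |t| ≤ 4 →
      (∀ x, x ≠ 0 → g x ≤ ENNReal.ofReal (C * (max ‖x‖ |t|)⁻¹)) →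
      (∀ x, x ≠ 0 → g x ≤ ENNReal.ofReal (C * (max ‖x‖ |t|) ^ (-(b + c)))) →
      WAx ψ (ENNReal.ofReal P) (ENNReal.ofReal p) g ≤ B * ENNReal.ofReal (|t| ^ (-c)) := by
  obtain ⟨M, hM⟩ := psi_bound hψ hψsupp
  set c1 : ℝ≥0∞ := M * (1 + volume (Metric.ball (0 : E3) 1) ^ (1 / P)) with hc1
  have hc1t : c1 ≠ ∞ := by
    refine ENNReal.mul_ne_top ENNReal.coe_ne_top (ENNReal.add_ne_top.2 ⟨ENNReal.one_ne_top, ?_⟩)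
    exact ENNReal.rpow_ne_top_of_nonneg (by positivity) measure_ball_lt_top.ne
  set J := LpE (volume : Measure E3) (ENNReal.ofReal p)
      (fun y => ENNReal.ofReal ((1 + ‖y‖)⁻¹)) with hJ
  have hJt : J ≠ ∞ := (LpE_japanese hp).ne
  have hp0 : ENNReal.ofReal p ≠ 0 := by simp; linarith
  have hP0 : ENNReal.ofReal P ≠ 0 := by simpa using hP
  set D := LpE (volume : Measure E3) (ENNReal.ofReal P) ((Metric.ball (0 : E3) 4).indicator
      fun x => ENNReal.ofReal (‖x‖ ^ (-b))) with hD
  have hDt : D ≠ ∞ := by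
    apply ne_of_lt
    apply LpE_local volume (by simp) hP0 ENNReal.ofReal_ne_top
    rw [ENNReal.toReal_ofReal hP.le]
    simpa using hbP
  refine ⟨(M * ENNReal.ofReal (C * 4) * D + c1 * ENNReal.ofReal (C * 4 * 4 ^ c)) * J,
    by finiteness, ?_⟩
  intro t g ht0 ht hg1 hg2
  have htp : 0 < |t| := abs_pos.2 ht0
  unfold WAx
  calc _ ≤ LpE volume (ENNReal.ofReal p) (fun y : E3 =>
        ((M * ENNReal.ofReal (C * 4) * D + c1 * ENNReal.ofReal (C * 4 * 4 ^ c)) *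
          ENNReal.ofReal (|t| ^ (-c))) * ENNReal.ofReal ((1 + ‖y‖)⁻¹)) := by
        apply LpE_mono_ae
        refine ae_of_all _ fun y => ?_
        rcases le_or_gt ‖y‖ 3 with hy | hy
        · calc _ ≤ LpE volume (ENNReal.ofReal P) (fun x => (M * ENNReal.ofReal (C * |t| ^ (-c))) *
                ((Metric.ball (0 : E3) 4).indicator
                  (fun x => ENNReal.ofReal (‖x‖ ^ (-b))) x)) := by
                apply LpE_mono_ae
                filter_upwards [ae_ne_zero_E3] with x hx
                by_cases h : x ∈ Metric.ball y 1
                · have h4 : x ∈ Metric.ball (0 : E3) 4 := by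
                    rw [Metric.mem_ball, dist_eq_norm] at h
                    rw [mem_ball_zero_iff]
                    have := norm_sub_norm_le x y
                    linarith
                  rw [Set.indicator_of_mem h4, mul_comm (M : ℝ≥0∞), mul_right_comm,
                    ← ENNReal.ofReal_mul (by positivity)]
                  have hxp : 0 < ‖x‖ := norm_pos_iff.2 hx
                  gcongr
                  · refine (hg2 x hx).trans (ENNReal.ofReal_le_ofReal ?_)
                    rw [mul_assoc, neg_add, Real.rpow_add (by positivity), mul_comm (|t| ^ (-c))]
                    apply mul_le_mul_of_nonneg_left _ hC
                    exact mul_le_mul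
                      (Real.rpow_le_rpow_of_nonpos hxp (le_max_left _ _) (by linarith))
                      (Real.rpow_le_rpow_of_nonpos htp (le_max_right _ _) (by linarith))
                      (by positivity) (by positivity)
                  · exact ENNReal.coe_le_coe.1 (hM _)
                · rw [psi_zero hψsupp h]; simp
            _ = (M * ENNReal.ofReal (C * |t| ^ (-c))) * D := by
                rw [LpE_const_mul hP0 (by finiteness)]
            _ ≤ (M * ENNReal.ofReal (C * 4) * D) * ENNReal.ofReal (|t| ^ (-c)) *
                  ENNReal.ofReal ((1 + ‖y‖)⁻¹) := by
                have h1 : (4:ℝ)⁻¹ ≤ (1 + ‖y‖)⁻¹ := inv_anti₀ (by positivity) (by linarith)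
                have h2 : 1 ≤ 4 * (1 + ‖y‖)⁻¹ := by linarith
                have h3 : 0 ≤ C * |t| ^ (-c) := by positivity
                have h4 : C * |t| ^ (-c) ≤ C * 4 * (|t| ^ (-c) * (1 + ‖y‖)⁻¹) := by nlinarith
                have h5 := ENNReal.ofReal_le_ofReal h4
                rw [ENNReal.ofReal_mul (p := C * 4) (by positivity),
                  ENNReal.ofReal_mul (p := |t| ^ (-c)) (by positivity)] at h5
                calc _ ≤ (M * (ENNReal.ofReal (C * 4) *
                        (ENNReal.ofReal (|t| ^ (-c)) * ENNReal.ofReal ((1 + ‖y‖)⁻¹)))) * D :=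
                      mul_le_mul' (mul_le_mul' le_rfl h5) le_rfl
                  _ = _ := by ring
            _ ≤ _ := by
                gcongr
                exact le_self_add
        · refine (inner_sup hψsupp hM hP g y (A := ENNReal.ofReal (C * (4 * (1 + ‖y‖)⁻¹)))
            ENNReal.ofReal_ne_top ?_).trans ?_
          · intro x hx hxy
            refine (hg1 x hx).trans (ENNReal.ofReal_le_ofReal ?_)
            gcongr
            rw [← div_eq_mul_inv, ← inv_div]
            apply inv_anti₀ (by positivity)
            rw [div_le_iff₀ (by norm_num)]
            have h1 : ‖y‖ ≤ ‖x‖ + 1 := by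
              rw [Metric.mem_ball, dist_eq_norm] at hxy
              have := norm_sub_norm_le y x
              rw [norm_sub_rev] at this
              linarith
            have h2 := le_max_left ‖x‖ |t|
            linarith
          · rw [← hc1]
            calc _ ≤ c1 * ENNReal.ofReal (C * 4 * 4 ^ c) * ENNReal.ofReal (|t| ^ (-c)) *
                  ENNReal.ofReal ((1 + ‖y‖)⁻¹) := by
                  rw [mul_comm _ c1, mul_assoc c1, mul_assoc c1,
                    ← ENNReal.ofReal_mul (by positivity), ← ENNReal.ofReal_mul (by positivity)]
                  refine mul_le_mul' le_rfl (ENNReal.ofReal_le_ofReal ?_)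
                  have h1 : (1:ℝ) ≤ 4 ^ c * |t| ^ (-c) := by
                    have : (4:ℝ) ^ (-c) ≤ |t| ^ (-c) :=
                      Real.rpow_le_rpow_of_nonpos htp ht (by linarith)
                    calc (1:ℝ) = 4 ^ c * 4 ^ (-c) := by
                          rw [← Real.rpow_add (by norm_num)]; simp
                      _ ≤ _ := by gcongr
                  have h2 : 0 ≤ C * (4 * (1 + ‖y‖)⁻¹) := by positivity
                  calc _ = C * (4 * (1 + ‖y‖)⁻¹) * 1 := by ring
                    _ ≤ C * (4 * (1 + ‖y‖)⁻¹) * (4 ^ c * |t| ^ (-c)) := by gcongr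
                    _ = _ := by ring
              _ ≤ _ := by
                  gcongr
                  exact le_add_self
    _ = _ := by
        rw [LpE_const_mul hp0 (by finiteness)]
        ring
lemma weak_bound {s : ℝ} (hs : 0 < s) {B : ℝ≥0∞} (hB : B ≠ ∞) {G : ℝ → ℝ≥0∞}
    (hG : ∀ k, k ≠ 0 → G k ≤ B * ENNReal.ofReal (|k| ^ (-(1 / s)))) : wkLp s G < ∞ := by
  have hd : 0 < 1 / s := by positivity
  set b := B.toReal with hb
  have hb0 : 0 ≤ b := ENNReal.toReal_nonneg
  have hBb : B = ENNReal.ofReal b := (ENNReal.ofReal_toReal hB).symm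
  refine lt_of_le_of_lt (b := ENNReal.ofReal (2 ^ (1 / s) * b)) ?_ ENNReal.ofReal_lt_top
  unfold wkLp
  refine iSup_le fun lam => ?_
  rcases eq_or_ne lam 0 with rfl | hl
  · simp
  have hlp : 0 < (lam : ℝ) := by positivity
  set R : ℝ := (b / lam) ^ s with hR
  have hR0 : 0 ≤ R := by positivity
  have hsub : {k : ℝ | (lam : ℝ≥0∞) < G k} ⊆ {0} ∪ Set.Icc (-R) R := by
    intro k hk
    rcases eq_or_ne k 0 with rfl | hk0
    · left; rfl
    right
    have hkp : 0 < |k| := abs_pos.2 hk0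
    have h1 : (lam : ℝ≥0∞) < B * ENNReal.ofReal (|k| ^ (-(1 / s))) := lt_of_lt_of_le hk (hG k hk0)
    rw [hBb, ← ENNReal.ofReal_mul hb0, ← ENNReal.ofReal_coe_nnreal] at h1
    have h2 := (ENNReal.ofReal_lt_ofReal_iff_of_nonneg hlp.le).1 h1
    rw [Real.rpow_neg hkp.le, ← div_eq_mul_inv, lt_div_iff₀ (by positivity)] at h2
    have h3 : |k| ^ (1 / s) ≤ b / lam := by
      rw [le_div_iff₀ hlp]; linarith
    have h4 : |k| ≤ R := by
      calc |k| = (|k| ^ (1 / s)) ^ s := by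
            rw [← Real.rpow_mul hkp.le, one_div_mul_cancel hs.ne', Real.rpow_one]
        _ ≤ R := Real.rpow_le_rpow (by positivity) h3 hs.le
    exact abs_le.1 h4
  have hvol : volume {k : ℝ | (lam : ℝ≥0∞) < G k} ≤ ENNReal.ofReal (2 * R) := by
    refine (measure_mono hsub).trans ((measure_union_le _ _).trans ?_)
    rw [Real.volume_singleton, Real.volume_Icc, zero_add]
    apply le_of_eq
    congr 1
    ring
  calc (lam : ℝ≥0∞) * (volume {k : ℝ | (lam : ℝ≥0∞) < G k}) ^ (1 / s)
      ≤ ENNReal.ofReal lam * (ENNReal.ofReal (2 * R)) ^ (1 / s) := by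
        rw [ENNReal.ofReal_coe_nnreal]
        gcongr
    _ = ENNReal.ofReal (2 ^ (1 / s) * b) := by
        rw [ENNReal.ofReal_rpow_of_nonneg (by positivity) hd.le, ← ENNReal.ofReal_mul hlp.le]
        congr 1
        rw [Real.mul_rpow (by norm_num) hR0, hR, ← Real.rpow_mul (by positivity),
          mul_one_div_cancel hs.ne', Real.rpow_one]
        field_simp

lemma phi_bound {φ : ℝ → ℝ} (hφ : Continuous φ) (hφsupp : Function.support φ ⊆ Set.Icc (-1) 1) :
    ∃ M : ℝ≥0, ∀ x, ‖φ x‖₊ ≤ M := by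
  have hcs : HasCompactSupport φ := by
    refine HasCompactSupport.intro (isCompact_Icc (a := (-1 : ℝ)) (b := 1)) ?_
    intro s hs
    by_contra h
    exact hs (hφsupp h)
  obtain ⟨M, hM⟩ := hφ.bounded_above_of_compact_support hcs
  refine ⟨M.toNNReal, fun x => ?_⟩
  rw [← NNReal.coe_le_coe]
  exact (hM x).trans (Real.le_coe_toNNReal M)

lemma outer_bound {φ : ℝ → ℝ} (hφ : Continuous φ)
    (hφsupp : Function.support φ ⊆ Set.Icc (-1) 1) {Q : ℝ≥0∞} (hQ0 : Q ≠ 0) {c d : ℝ}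
    (hd : 0 < d) (hcQ : Q ≠ ∞ → c * Q.toReal < 1) (hcQ' : Q = ∞ → c = 0)
    {B1 B2 : ℝ≥0∞} (hB1 : B1 ≠ ∞) (hB2 : B2 ≠ ∞) {h : ℝ → ℝ≥0∞}
    (H1 : ∀ t, t ≠ 0 → |t| ≤ 4 → h t ≤ B1 * ENNReal.ofReal (|t| ^ (-c)))
    (H2 : ∀ t, 1 ≤ |t| → h t ≤ B2 * ENNReal.ofReal (|t| ^ (-d))) :
    ∃ B : ℝ≥0∞, B ≠ ∞ ∧ ∀ k, k ≠ 0 →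
      LpE volume Q (fun t => h t * ‖φ (t - k)‖₊) ≤ B * ENNReal.ofReal (|k| ^ (-d)) := by
  obtain ⟨M, hM⟩ := phi_bound hφ hφsupp
  have hz : ∀ t k : ℝ, t ∉ Set.Icc (k - 1) (k + 1) → φ (t - k) = 0 := by
    intro t k ht
    by_contra h'
    apply ht
    have := hφsupp h'
    rw [Set.mem_Icc] at this ⊢
    constructor <;> linarith [this.1, this.2]
  -- local quantity
  obtain ⟨D, hD, hDk⟩ : ∃ D : ℝ≥0∞, D ≠ ∞ ∧ ∀ k : ℝ, |k| ≤ 3 →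
      LpE volume Q (fun t => h t * ‖φ (t - k)‖₊) ≤ D := by
    set L := LpE (volume : Measure ℝ) Q
      ((Metric.ball (0 : ℝ) 5).indicator fun x => ENNReal.ofReal (‖x‖ ^ (-c))) with hL
    have hLt : L ≠ ∞ := by
      by_cases hQ : Q = ∞
      · have hc0 := hcQ' hQ
        rw [hL, hc0]
        simp only [neg_zero, Real.rpow_zero, ENNReal.ofReal_one]
        refine ne_top_of_le_ne_top ?_ (LpE_indicator_le hQ0 measurableSet_ball)
        refine ENNReal.add_ne_top.2 ⟨ENNReal.one_ne_top, ?_⟩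
        exact ENNReal.rpow_ne_top_of_nonneg (by positivity) measure_ball_lt_top.ne
      · exact (LpE_local volume (by simp) hQ0 hQ 5 (by simpa using hcQ hQ)).ne
    refine ⟨(B1 * M) * L, by finiteness, fun k hk => ?_⟩
    rw [hL, ← LpE_const_mul hQ0 (by finiteness)]
    apply LpE_mono_ae
    have hae : ∀ᵐ t : ℝ, t ≠ 0 := by
      rw [ae_iff]
      simp
    filter_upwards [hae] with t ht
    by_cases hm : t ∈ Set.Icc (k - 1) (k + 1)
    · have h4 : |t| ≤ 4 := by
        rw [Set.mem_Icc] at hm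
        rw [abs_le] at hk ⊢
        constructor <;> linarith [hm.1, hm.2, hk.1, hk.2]
      have h5 : t ∈ Metric.ball (0 : ℝ) 5 := by
        rw [mem_ball_zero_iff, Real.norm_eq_abs]; linarith
      rw [Set.indicator_of_mem h5, mul_right_comm]
      exact mul_le_mul' (H1 t ht h4) (ENNReal.coe_le_coe.2 (hM _))
    · rw [hz t k hm]; simp
  set V : ℝ≥0∞ := 1 + ENNReal.ofReal 2 ^ (1 / Q.toReal) with hV
  have hVt : V ≠ ∞ := by
    refine ENNReal.add_ne_top.2 ⟨ENNReal.one_ne_top, ?_⟩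
    exact ENNReal.rpow_ne_top_of_nonneg (by positivity) ENNReal.ofReal_ne_top
  refine ⟨D * ENNReal.ofReal (3 ^ d) + B2 * ENNReal.ofReal (2 ^ d) * M * V, by finiteness, ?_⟩
  intro k hk0
  have hkp : 0 < |k| := abs_pos.2 hk0
  rw [add_mul]
  rcases le_or_gt |k| 3 with hk | hk
  · refine (hDk k hk).trans (le_trans ?_ le_self_add)
    rw [mul_assoc, ← ENNReal.ofReal_mul (by positivity)]
    have h1 : (1:ℝ) ≤ 3 ^ d * |k| ^ (-d) := by
      have : (3:ℝ) ^ (-d) ≤ |k| ^ (-d) :=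
        Real.rpow_le_rpow_of_nonpos hkp hk (by linarith)
      calc (1:ℝ) = 3 ^ d * 3 ^ (-d) := by
            rw [← Real.rpow_add (by norm_num)]; simp
        _ ≤ _ := mul_le_mul_of_nonneg_left this (by positivity)
    calc D = D * ENNReal.ofReal 1 := by simp
      _ ≤ _ := mul_le_mul' le_rfl (ENNReal.ofReal_le_ofReal h1)
  · refine le_trans ?_ le_add_self
    calc _ ≤ LpE volume Q (fun t => (B2 * ENNReal.ofReal (2 ^ d) * M * ENNReal.ofReal (|k| ^ (-d))) *
          (Set.Icc (k - 1) (k + 1)).indicator (fun _ => 1) t) := by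
          apply LpE_mono_ae
          refine ae_of_all _ fun t => ?_
          by_cases hm : t ∈ Set.Icc (k - 1) (k + 1)
          · rw [Set.indicator_of_mem hm, mul_one]
            have htk : |k| / 2 ≤ |t| := by
              rw [Set.mem_Icc] at hm
              have h1 : |k - t| ≤ 1 := by
                rw [abs_le]; constructor <;> linarith [hm.1, hm.2]
              have := abs_sub_abs_le_abs_sub k t
              linarith
            have h2 : |t| ^ (-d) ≤ 2 ^ d * |k| ^ (-d) := by
              calc |t| ^ (-d) ≤ (|k| / 2) ^ (-d) :=
                    Real.rpow_le_rpow_of_nonpos (by positivity) htk (by linarith)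
                _ = 2 ^ d * |k| ^ (-d) := by
                    rw [Real.div_rpow hkp.le (by norm_num), Real.rpow_neg (x := 2) (by norm_num)]
                    field_simp
            calc _ ≤ (B2 * ENNReal.ofReal (2 ^ d * |k| ^ (-d))) * M :=
                  mul_le_mul' ((H2 t (by linarith)).trans
                    (mul_le_mul' le_rfl (ENNReal.ofReal_le_ofReal h2)))
                    (ENNReal.coe_le_coe.2 (hM _))
              _ = _ := by
                  rw [ENNReal.ofReal_mul (by positivity)]
                  ring
          · rw [hz t k hm]; simp
      _ = (B2 * ENNReal.ofReal (2 ^ d) * M * ENNReal.ofReal (|k| ^ (-d))) *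
            LpE volume Q ((Set.Icc (k - 1) (k + 1)).indicator (fun _ => 1)) := by
          rw [LpE_const_mul hQ0 (by finiteness)]
      _ ≤ (B2 * ENNReal.ofReal (2 ^ d) * M * ENNReal.ofReal (|k| ^ (-d))) * V := by
          refine mul_le_mul' le_rfl ((LpE_indicator_le hQ0 measurableSet_Icc).trans (le_of_eq ?_))
          rw [Real.volume_Icc, hV]
          congr 3
          ring
      _ = _ := by ring

lemma choose_exp {g s u : ℝ} (hg : g < 1) (hs : 0 < s) (hu : 0 ≤ u) (h : g < s + u) :
    ∃ b c : ℝ, 0 ≤ b ∧ 0 ≤ c ∧ b + c ≤ 1 ∧ g < b + c ∧ b < s ∧ (0 < u → c < u) ∧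
      (u = 0 → c = 0) := by
  obtain ⟨a, ha1, ha2⟩ : ∃ a, max g 0 < a ∧ a < min 1 (s + u) := by
    apply exists_between
    rw [max_lt_iff, lt_min_iff, lt_min_iff]
    exact ⟨⟨hg, h⟩, by norm_num, by positivity⟩
  rw [max_lt_iff] at ha1
  rw [lt_min_iff] at ha2
  have hsu : 0 < s + u := by positivity
  have hb : a * s / (s + u) + a * u / (s + u) = a := by field_simp
  have ha0 := ha1.2
  refine ⟨a * s / (s + u), a * u / (s + u), by positivity, by positivity, by linarith [ha2.1],
    by linarith [ha1.1], ?_, ?_, ?_⟩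
  · rw [div_lt_iff₀ hsu]; nlinarith [ha2.2]
  · intro hu'
    rw [div_lt_iff₀ hsu]; nlinarith [ha2.2]
  · rintro rfl
    simp

theorem Kker_weak_norm_finite (σ : ℝ) (hσ : 1 < σ) (q' : ℝ≥0∞) (hq' : 2 ≤ q')
    (q r r' : ℝ) (hq : 2 < q) (hr6 : 6 < r) (hrr : r ≤ r')
    (hcond1 : (q'⁻¹).toReal + 3 / r' > 3 / 2 - σ) (hcond2 : 1 / q + 3 / r = 1 / 2)
    (ρ : ℝ → ℝ)
    (hρ : ContDiff ℝ (⊤ : ℕ∞) ρ) (hρsupp : Function.support ρ ⊆ Set.Ioo (-2) 2)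
    (hρ1 : ∀ s : ℝ, |s| ≤ 1 → ρ s = 1)
    (ψ : EuclideanSpace ℝ (Fin 3) → ℝ) (hψ : ContDiff ℝ (⊤ : ℕ∞) ψ)
    (hψsupp : Function.support ψ ⊆ Metric.ball 0 1) (hψne : ψ ≠ 0)
    (φ : ℝ → ℝ) (hφ : ContDiff ℝ (⊤ : ℕ∞) φ)
    (hφsupp : Function.support φ ⊆ Set.Icc (-1) 1) (hφne : φ ≠ 0) :
    wkLp (q / 2) (fun k =>
      LpE MeasureTheory.volume (q' / 2) (fun t =>
        WAx ψ (ENNReal.ofReal (r' / 2)) (ENNReal.ofReal (r / 2))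
            (fun x => (‖Kker ρ (2 * σ) x t‖₊ : ℝ≥0∞)) * ‖φ (t - k)‖₊)) < ∞ := by
  have hQ0 : q' / 2 ≠ 0 := by
    rw [Ne, ENNReal.div_eq_zero_iff]
    push Not
    exact ⟨fun h => by simp [h] at hq', by norm_num⟩
  have hr'0 : 0 < r' := by linarith
  have hr0 : 0 < r := by linarith
  have hq0 : 0 < q := by linarith
  set u : ℝ := 2 * (q'⁻¹).toReal with hu
  have hu0 : 0 ≤ u := by positivity
  obtain ⟨b, c, hb, hc, hbc1, hbc, hbs, hcu, hcu0⟩ := choose_exp (g := 3 - 2 * σ) (s := 6 / r')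
    (u := u) (by linarith) (by positivity) hu0 (by
      have : 6 / r' = 2 * (3 / r') := by ring
      rw [this]; linarith)
  obtain ⟨C1, hC1, hK1⟩ := Kker_bound (hρ.of_le (by exact_mod_cast le_top)) hρsupp hρ1
    (γ := 2 * σ) (a := 1) (by linarith) (by norm_num) le_rfl (by linarith)
  obtain ⟨C2, hC2, hK2⟩ := Kker_bound (hρ.of_le (by exact_mod_cast le_top)) hρsupp hρ1
    (γ := 2 * σ) (a := b + c) (by linarith) (by linarith) hbc1 hbc
  set C := max C1 C2 with hCdef
  have hC : 0 ≤ C := hC1.trans (le_max_left _ _)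
  have hG1 : ∀ t, t ≠ 0 → ∀ x : E3, x ≠ 0 →
      (‖Kker ρ (2 * σ) x t‖₊ : ℝ≥0∞) ≤ ENNReal.ofReal (C * (max ‖x‖ |t|)⁻¹) := by
    intro t ht x hx
    rw [← enorm_eq_nnnorm, ← ofReal_norm]
    apply ENNReal.ofReal_le_ofReal
    have := hK1 x t hx ht
    rw [Real.rpow_neg_one] at this
    exact this.trans (mul_le_mul_of_nonneg_right (le_max_left _ _) (by positivity))
  have hG2 : ∀ t, t ≠ 0 → ∀ x : E3, x ≠ 0 →
      (‖Kker ρ (2 * σ) x t‖₊ : ℝ≥0∞) ≤ ENNReal.ofReal (C * (max ‖x‖ |t|) ^ (-(b + c))) := by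
    intro t ht x hx
    rw [← enorm_eq_nnnorm, ← ofReal_norm]
    apply ENNReal.ofReal_le_ofReal
    exact (hK2 x t hx ht).trans (mul_le_mul_of_nonneg_right (le_max_right _ _) (by positivity))
  obtain ⟨B1, hB1, H1⟩ := h_small hψ.continuous hψsupp (P := r' / 2) (p := r / 2) (by linarith)
    (by positivity) hC hb hc (by
      rw [lt_div_iff₀ hr'0] at hbs
      linarith)
  obtain ⟨B2, hB2, H2⟩ := h_large hψ.continuous hψsupp (P := r' / 2) (p := r / 2) (by linarith)
    (by positivity) hC
  have hd : (-1 + 3 / (r / 2)) = -(1 / (q / 2)) := by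
    have e1 : 3 / (r / 2) = 2 * (3 / r) := by field_simp
    have e2 : 1 / (q / 2) = 2 * (1 / q) := by field_simp
    rw [e1, e2]; linarith
  rw [hd] at H2
  obtain ⟨B, hB, H⟩ := outer_bound hφ.continuous hφsupp hQ0 (c := c) (d := 1 / (q / 2))
    (by positivity) (by
      intro hQ
      have hq't : q' ≠ ∞ := by
        rintro rfl
        exact hQ (ENNReal.top_div_of_ne_top (by norm_num))
      have hq'p : 0 < q'.toReal :=
        ENNReal.toReal_pos (fun h => by simp [h] at hq') hq't
      rw [ENNReal.toReal_inv] at hu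
      have hup : 0 < u := by rw [hu]; positivity
      have h1 := hcu hup
      rw [ENNReal.toReal_div]
      simp only [ENNReal.toReal_ofNat]
      calc c * (q'.toReal / 2) < u * (q'.toReal / 2) := by gcongr
        _ = 1 := by rw [hu]; field_simp)
    (by
      intro hQ
      apply hcu0
      have hq't : q' = ∞ := by
        by_contra h
        exact ENNReal.div_ne_top h (by norm_num) hQ
      rw [hu, hq't]; simp)
    hB1 hB2 (fun t ht0 ht => H1 t _ ht0 ht (hG1 t ht0) (hG2 t ht0))
    (fun t ht => H2 t _ ht (hG1 t (by rintro rfl; norm_num at ht)))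
  exact weak_bound (by positivity) hB H

end
end
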